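/- The only pairs (d, w) ∈ ℚ × ℚ satisfying (−2d + 1)w³ + (2d − 1)w² + (−d² − d + 1)w + d² − d = 0 are (d, w) ∈ {(0, 0), (1, 0), (1/2, 1)}. -/

import Mathlib

namespace N3M3

abbrev Gi := GaussianInt
def I : Gi := ⟨0, 1⟩
def pi : Gi := ⟨1, 1⟩
def ka : Gi := ⟨5, -4⟩
def Od (x : Gi) : Prop := (x.re + x.im) % 2 = 1

@[simp] lemma I_re : I.re = 0 := rfl
@[simp] lemma I_im : I.im = 1 := rfl
@[simp] lemma pi_re : pi.re = 1 := rfl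
@[simp] lemma pi_im : pi.im = 1 := rfl
@[simp] lemma ka_re : ka.re = 5 := rfl
@[simp] lemma ka_im : ka.im = -4 := rfl
lemma I_sq : I ^ 2 = -1 := by rfl
lemma pi_eq : pi = 1 + I := by rfl
lemma ka_eq : ka = 5 - 4 * I := by rfl

@[simp] lemma ofNat_re' (n : ℕ) [n.AtLeastTwo] : (OfNat.ofNat n : Gi).re = OfNat.ofNat n := by
  exact Zsqrtd.re_ofNat n
@[simp] lemma ofNat_im' (n : ℕ) [n.AtLeastTwo] : (OfNat.ofNat n : Gi).im = 0 := by
  exact Zsqrtd.im_ofNat n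

lemma re_of_eq {x y : Gi} (h : x = y) : x.re = y.re := by rw [h]
lemma im_of_eq {x y : Gi} (h : x = y) : x.im = y.im := by rw [h]

lemma pi_dvd_iff (x : Gi) : pi ∣ x ↔ (x.re + x.im) % 2 = 0 := by
  constructor
  · rintro ⟨y, rfl⟩
    simp
    omega
  · intro h
    refine ⟨⟨(x.re + x.im) / 2, (x.im - x.re) / 2⟩, ?_⟩
    ext <;> simp <;> omega

lemma not_od (x : Gi) : ¬ Od x ↔ pi ∣ x := by
  rw [pi_dvd_iff, Od]; omega

lemma od_iff (x : Gi) : Od x ↔ ¬ pi ∣ x := by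
  rw [← not_od, not_not]

lemma pi_prime : Prime pi := by
  refine ⟨by decide, ?_, ?_⟩
  · intro h
    have := (pi_dvd_iff 1).1 h.dvd
    simp at this
  · intro a b h
    have h0 := (pi_dvd_iff _).1 h
    rw [pi_dvd_iff, pi_dvd_iff]
    by_contra hc
    push Not at hc
    obtain ⟨h1, h2⟩ := hc
    have e1 : (a * b).re + (a * b).im = (a.re + a.im) * (b.re + b.im) - 2 * (a.im * b.im) := by
      simp only [Zsqrtd.re_mul, Zsqrtd.im_mul]; ring
    have h3 : ((a.re + a.im) * (b.re + b.im)) % 2 = 1 := by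
      rw [Int.mul_emod, show (a.re + a.im) % 2 = 1 by omega, show (b.re + b.im) % 2 = 1 by omega]
      rfl
    omega

lemma od_mul {x y : Gi} : Od (x * y) ↔ Od x ∧ Od y := by
  rw [od_iff, od_iff, od_iff, pi_prime.dvd_mul]; tauto

lemma od_pow {x : Gi} {n : ℕ} (h : Od x) : Od (x ^ n) := by
  rw [od_iff] at *
  exact fun h' => h (pi_prime.dvd_of_dvd_pow h')

lemma od_of_pow {x : Gi} {n : ℕ} (hn : n ≠ 0) (h : Od (x ^ n)) : Od x := by
  rw [od_iff] at *
  exact fun h' => h (dvd_pow h' hn)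

lemma ka_irred : Prime ka := by
  rw [← irreducible_iff_prime]
  have hp : Irreducible (Zsqrtd.norm ka) := by
    rw [show Zsqrtd.norm ka = 41 by decide]
    exact Int.prime_iff_natAbs_prime.2 (by norm_num) |>.irreducible
  constructor
  · intro h
    rw [← Zsqrtd.norm_eq_one_iff] at h
    revert h; decide
  · intro a b h
    have h2 : Zsqrtd.norm ka = Zsqrtd.norm a * Zsqrtd.norm b := by rw [h, Zsqrtd.norm_mul]
    rcases hp.isUnit_or_isUnit h2 with h3 | h3
    · left; rw [← Zsqrtd.norm_eq_one_iff]; exact Int.isUnit_iff_natAbs_eq.1 h3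
    · right; rw [← Zsqrtd.norm_eq_one_iff]; exact Int.isUnit_iff_natAbs_eq.1 h3

lemma units_cases {e e' : Gi} (h : e * e' = 1) :
    (e = 1 ∧ e' = 1) ∨ (e = -1 ∧ e' = -1) ∨ (e = I ∧ e' = -I) ∨ (e = -I ∧ e' = I) := by
  have hu : IsUnit e := IsUnit.of_mul_eq_one _ h
  have hn : e.re * e.re + e.im * e.im = 1 := by
    have h1 := (Zsqrtd.norm_eq_one_iff).2 hu
    have h2 : 0 ≤ Zsqrtd.norm e := GaussianInt.norm_nonneg e
    have h3 : Zsqrtd.norm e = 1 := by omega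
    rw [Zsqrtd.norm_def] at h3
    linarith
  have b1 : e.re ≤ 1 := by nlinarith
  have b2 : -1 ≤ e.re := by nlinarith
  have b3 : e.im ≤ 1 := by nlinarith
  have b4 : -1 ≤ e.im := by nlinarith
  have hI : I * I = -1 := rfl
  obtain ⟨x, y⟩ := e
  simp only at hn b1 b2 b3 b4
  interval_cases x <;> interval_cases y <;> simp at hn
  · right; left
    have : (⟨-1, 0⟩ : Gi) = -1 := rfl
    rw [this] at h ⊢
    exact ⟨rfl, by linear_combination -h⟩
  · right; right; right
    have : (⟨0, -1⟩ : Gi) = -I := rfl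
    rw [this] at h ⊢
    exact ⟨rfl, by linear_combination I * h + e' * hI⟩
  · right; right; left
    have : (⟨0, 1⟩ : Gi) = I := rfl
    rw [this] at h ⊢
    exact ⟨rfl, by linear_combination -I * h + e' * hI⟩
  · left
    have : (⟨1, 0⟩ : Gi) = 1 := rfl
    rw [this] at h ⊢
    exact ⟨rfl, by linear_combination h⟩

lemma I_mul : I * I = -1 := rfl

/-- squares of odd Gaussian integers -/
lemma sq_form {x : Gi} (h : Od x) :
    ∃ y, x ^ 2 = 1 + 4 * pi * y ∨ x ^ 2 = -1 + 4 * pi * y := by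
  have key : ∀ w : Gi, ∃ y, w * (w + 1) = pi * y := by
    intro w
    by_cases hw : Od w
    · have : pi ∣ w + 1 := by
        rw [pi_dvd_iff]; unfold Od at hw; simp; omega
      exact (this.mul_left w)
    · rw [not_od] at hw
      exact hw.mul_right _
  unfold Od at h
  rcases Int.emod_two_eq_zero_or_one x.im with h1 | h1
  · obtain ⟨y, hy⟩ := key ⟨(x.re - 1) / 2, x.im / 2⟩
    refine ⟨y, Or.inl ?_⟩
    have hx : x = 1 + 2 * ⟨(x.re - 1) / 2, x.im / 2⟩ := by
      ext <;> simp <;> omega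
    rw [hx]
    linear_combination 4 * hy
  · obtain ⟨y, hy⟩ := key ⟨(x.im - 1) / 2, - x.re / 2⟩
    refine ⟨-y, Or.inr ?_⟩
    have hx : x = I * (1 + 2 * ⟨(x.im - 1) / 2, - x.re / 2⟩) := by
      ext <;> simp <;> omega
    rw [hx]
    generalize (⟨(x.im - 1) / 2, - x.re / 2⟩ : Gi) = z at *
    linear_combination (1 + 2 * z) ^ 2 * I_mul - 4 * hy

lemma four_form {x : Gi} (h : Od x) : ∃ y, x ^ 4 = 1 + 8 * pi * y := by
  obtain ⟨y, hy | hy⟩ := sq_form h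
  · exact ⟨y + 2 * pi * y ^ 2, by linear_combination (x ^ 2 + 1 + 4 * pi * y) * hy⟩
  · exact ⟨-y + 2 * pi * y ^ 2, by linear_combination (x ^ 2 - 1 + 4 * pi * y) * hy⟩

/-- general factorization lemma -/
lemma FL (k : ℕ) (hk : k ≠ 0) {u v q r b : Gi} (hc : IsCoprime u v) (hq : q ∣ u) (hr : r ∣ v)
    (hq0 : q ≠ 0) (hr0 : r ≠ 0) (hb : b ≠ 0) (h : u * v = q * r * b ^ k) :
    ∃ e e' c d : Gi, e * e' = 1 ∧ u = q * (e * c ^ k) ∧ v = r * (e' * d ^ k) ∧ c * d = b := by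
  obtain ⟨u1, rfl⟩ := hq
  obtain ⟨v1, rfl⟩ := hr
  have h1 : u1 * v1 = b ^ k := by
    apply mul_left_cancel₀ (mul_ne_zero hq0 hr0)
    linear_combination h
  have hc1 : IsCoprime u1 v1 := (hc.of_mul_left_right).of_mul_right_right
  obtain ⟨c, hc2⟩ := exists_associated_pow_of_mul_eq_pow' hc1 h1
  obtain ⟨d, hd2⟩ := exists_associated_pow_of_mul_eq_pow' hc1.symm (by rw [mul_comm]; exact h1)
  obtain ⟨x, hx⟩ := hc2
  obtain ⟨y, hy⟩ := hd2
  have hbk : b ^ k ≠ 0 := pow_ne_zero _ hb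
  have hass : Associated ((c * d) ^ k) (b ^ k) := by
    refine ⟨x * y, ?_⟩
    rw [← h1, ← hx, ← hy]; push_cast; ring
  have d1 : c * d ∣ b := (UniqueFactorizationMonoid.pow_dvd_pow_iff_dvd hk).1 hass.dvd
  have d2 : b ∣ c * d := (UniqueFactorizationMonoid.pow_dvd_pow_iff_dvd hk).1 hass.symm.dvd
  obtain ⟨z, hz⟩ := associated_of_dvd_dvd d1 d2
  have hx0 : (x : Gi) * ↑x⁻¹ = 1 := x.mul_inv
  refine ⟨x, ↑x⁻¹, c, d * z, hx0, ?_, ?_, by rw [← hz]; ring⟩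
  · rw [← hx]; ring
  · have hc0 : c ^ k ≠ 0 := by
      intro h0
      apply hbk
      rw [← h1, ← hx, h0]; ring
    congr 1
    apply mul_left_cancel₀ hc0
    apply mul_left_cancel₀ x.ne_zero
    have e1 : c ^ k * x * v1 = (c * d * z) ^ k := by rw [hx, h1, hz]
    calc (x : Gi) * (c ^ k * v1) = c ^ k * x * v1 := by ring
      _ = (c * d * z) ^ k := e1
      _ = (x * ↑x⁻¹) * (c * d * z) ^ k := by rw [hx0, one_mul]
      _ = _ := by ring
end N3M3

namespace N3M3

lemma od_coprime_pi {x : Gi} (h : Od x) : IsCoprime x pi := by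
  rw [od_iff] at h
  exact ((pi_prime.irreducible.coprime_iff_not_dvd).2 h).symm

lemma od_add_even {x y : Gi} (h : Od x) (hy : pi ∣ y) : Od (x + y) := by
  rw [od_iff] at *
  intro h2; exact h ((dvd_add_left hy).1 h2)

lemma pi_dvd_two : pi ∣ 2 := ⟨1 - I, by rfl⟩
lemma two_eq : (2 : Gi) = pi * (1 - I) := by rfl
lemma pi_ne : pi ≠ 0 := pi_prime.ne_zero
lemma ka_ne : ka ≠ 0 := ka_irred.ne_zero

lemma od_sub_od {x y : Gi} (h : Od x) (hy : Od y) : pi ∣ x - y := by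
  rw [pi_dvd_iff]; unfold Od at *; simp; omega

lemma dsq {P e m : Gi} (hP : Od P) (h : e ^ 2 = P ^ 2 + 4 * m) (hm : pi ∣ m) :
    ∃ u v, P = u - v ∧ u * v = m ∧ pi ∣ v ∧ Od u := by
  have he : Od e := by
    apply od_of_pow (n := 2) (by norm_num)
    rw [h]; exact od_add_even (od_pow hP) (hm.mul_left 4)
  obtain ⟨x, hx⟩ := od_sub_od he hP
  obtain ⟨m1, rfl⟩ := hm
  have h1 : x * (x + (1 - I) * P) = pi * ((1 - I) ^ 2 * m1) := by
    have h3 : e = P + pi * x := by linear_combination hx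
    rw [h3] at h
    apply mul_left_cancel₀ (mul_ne_zero pi_ne pi_ne)
    have h2 : pi * (1 - I) = 2 := by rfl
    linear_combination h + (x * P * pi - (pi * (1 - I) + 2) * pi * m1) * h2
  have hpx : pi ∣ x := by
    have h2 : pi ∣ (1 - I) := ⟨-I, by rfl⟩
    rcases pi_prime.dvd_or_dvd (Dvd.intro _ h1.symm) with h3 | h3
    · exact h3
    · exact (dvd_add_left (h2.mul_right P)).1 h3
  obtain ⟨z, rfl⟩ := hpx
  have hpp : pi * pi = 2 * I := by rfl
  have h4 : e = P + 2 * (I * z) := by linear_combination hx + z * hpp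
  generalize I * z = y at *
  have h5 : y * (y + P) = pi * m1 := by
    have h4' : (4 : Gi) ≠ 0 := by decide
    apply mul_left_cancel₀ h4'
    rw [h4] at h
    linear_combination h
  rcases pi_prime.dvd_or_dvd (Dvd.intro _ h5.symm) with h3 | h3
  · refine ⟨y + P, y, by ring, by rw [← h5]; ring, h3, ?_⟩
    rw [add_comm]; exact od_add_even hP h3
  · refine ⟨-y, -(y + P), by ring, by rw [← h5]; ring, h3.neg_right, ?_⟩
    have := od_add_even hP h3.neg_right
    convert this using 1; ring

lemma od_ne {x : Gi} (h : Od x) : x ≠ 0 := by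
  rintro rfl; unfold Od at h; simp at h

lemma Spl (k : ℕ) (hk : k ≠ 0) {P e K r b : Gi} (n : ℕ) (hP : Od P) (hK : K = 1 ∨ Prime K)
    (hr : r ∣ pi ^ n) (hb : b ≠ 0) (hc : IsCoprime P b)
    (h : e ^ 2 = P ^ 2 + 4 * (K * r * b ^ k)) (hm : pi ∣ K * r * b ^ k) :
    ∃ e1 e2 c d : Gi, e1 * e2 = 1 ∧ c * d = b ∧ Od c ∧ IsCoprime c d ∧
     ((P = e1 * c ^ k - K * r * e2 * d ^ k ∧ pi ∣ K * r * d ^ k) ∨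
      (P = K * e1 * c ^ k - r * e2 * d ^ k ∧ pi ∣ r * d ^ k)) := by
  obtain ⟨u, v, h1, h2, h3, h4⟩ := dsq hP h hm
  have hr0 : r ≠ 0 := by
    rintro rfl; exact pow_ne_zero n pi_ne (zero_dvd_iff.1 hr)
  have hK0 : K ≠ 0 := by
    rcases hK with rfl | hK
    · exact one_ne_zero
    · exact hK.ne_zero
  have hcuv : IsCoprime u v := by
    apply isCoprime_of_prime_dvd
    · intro h5; exact od_ne h4 h5.1
    · intro p hp hu hv
      have hpP : p ∣ P := by rw [h1]; exact dvd_sub hu hv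
      have hpp : p * p ∣ K * (r * b ^ k) := by
        rw [← mul_assoc, ← h2]; exact mul_dvd_mul hu hv
      have hpz : p ∣ r * b ^ k := by
        rcases hK with rfl | hK
        · rw [one_mul] at hpp; exact (dvd_mul_right p p).trans hpp
        · rcases hp.dvd_or_dvd ((dvd_mul_right p p).trans hpp) with h6 | h6
          · obtain ⟨w, hw⟩ := (hp.irreducible.associated_of_dvd hK.irreducible h6)
            rw [← hw, mul_assoc] at hpp
            have := (mul_dvd_mul_iff_left hp.ne_zero).1 hpp
            exact (Units.dvd_mul_left).1 this
          · exact h6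
      rcases hp.dvd_or_dvd hpz with h6 | h6
      · have h7 := hp.dvd_of_dvd_pow (h6.trans hr)
        have h8 := hp.irreducible.associated_of_dvd pi_prime.irreducible h7
        exact (od_iff u).1 h4 (h8.symm.dvd.trans hu)
      · have h7 := hp.dvd_of_dvd_pow h6
        exact hp.not_isUnit (hc.isUnit_of_dvd' hpP h7)
  have hru : IsCoprime r u := ((od_coprime_pi h4).symm.pow_left (m := n)).of_isCoprime_of_dvd_left hr
  have hrv : r ∣ v := hru.dvd_of_dvd_mul_left ⟨K * b ^ k, by rw [h2]; ring⟩
  have hKuv : K ∣ v ∨ K ∣ u := by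
    rcases hK with rfl | hK
    · left; exact one_dvd _
    · exact (hK.dvd_or_dvd (a := u) (b := v) ⟨r * b ^ k, by rw [h2]; ring⟩).symm
  have fin : ∀ {q s : Gi}, q ∣ u → s ∣ v → q ≠ 0 → s ≠ 0 → u * v = q * s * b ^ k →
      ∃ e1 e2 c d : Gi, e1 * e2 = 1 ∧ c * d = b ∧ Od c ∧ IsCoprime c d ∧
        P = q * (e1 * c ^ k) - s * (e2 * d ^ k) ∧ pi ∣ s * d ^ k := by
    intro q s hq hs hq0 hs0 hh
    obtain ⟨e1, e2, c, d, he, hu, hv, hcd⟩ := FL k hk hcuv hq hs hq0 hs0 hb hh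
    refine ⟨e1, e2, c, d, he, hcd, ?_, ?_, ?_, ?_⟩
    · rw [hu] at h4
      exact od_of_pow hk (od_mul.1 (od_mul.1 h4).2).2
    · rw [hu, hv] at hcuv
      have := (hcuv.of_mul_left_right.of_mul_left_right).of_mul_right_right.of_mul_right_right
      exact (IsCoprime.pow_iff (Nat.pos_of_ne_zero hk) (Nat.pos_of_ne_zero hk)).1 this
    · rw [h1, hu, hv]
    · have : s * d ^ k = e1 * v := by
        rw [hv]; linear_combination (- s * d ^ k) * he
      rw [this]; exact h3.mul_left _
  rcases hKuv with h5 | h5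
  · have hKr : K * r ∣ v := by
      have h9 : r ∣ pi ^ n := hr
      rcases hK with rfl | hK
      · simpa using hrv
      · by_cases hKp : K ∣ pi
        · have h8 := hK.irreducible.associated_of_dvd pi_prime.irreducible hKp
          have hKu : IsCoprime K u := ((od_coprime_pi h4).symm).of_isCoprime_of_dvd_left hKp
          exact (hKu.mul_left hru).dvd_of_dvd_mul_left ⟨b ^ k, by rw [h2]⟩
        · have : IsCoprime K (pi ^ n) := ((hK.irreducible.coprime_iff_not_dvd).2 hKp).pow_right
          exact (this.of_isCoprime_of_dvd_right hr).mul_dvd h5 hrv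
    obtain ⟨e1, e2, c, d, he, hcd, ho, hcc, hP', hd⟩ := fin (one_dvd u) hKr one_ne_zero
      (mul_ne_zero hK0 hr0) (by rw [h2]; ring)
    exact ⟨e1, e2, c, d, he, hcd, ho, hcc, Or.inl ⟨by rw [hP']; ring, hd⟩⟩
  · obtain ⟨e1, e2, c, d, he, hcd, ho, hcc, hP', hd⟩ := fin h5 hrv hK0 hr0 (by rw [h2])
    exact ⟨e1, e2, c, d, he, hcd, ho, hcc, Or.inr ⟨by rw [hP']; ring, hd⟩⟩

lemma upm {e e' c w : Gi} (h : e * e' = 1) (hc : Od c) (hw : e * c ^ 2 = 1 + 2 * w) :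
    (e = 1 ∧ e' = 1) ∨ (e = -1 ∧ e' = -1) := by
  obtain ⟨y, hy⟩ := sq_form hc
  rcases units_cases h with h1 | h1 | h1 | h1
  · exact Or.inl h1
  · exact Or.inr h1
  · exfalso
    rw [h1.1] at hw
    rcases hy with hy | hy <;> rw [hy] at hw <;> have := re_of_eq hw <;> simp at this <;> omega
  · exfalso
    rw [h1.1] at hw
    rcases hy with hy | hy <;> rw [hy] at hw <;> have := re_of_eq hw <;> simp at this <;> omega

lemma upm4 {e e' c w : Gi} (h : e * e' = 1) (hc : Od c) (hw : e * c ^ 4 = 1 + 2 * w) :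
    (e = 1 ∧ e' = 1) ∨ (e = -1 ∧ e' = -1) :=
  upm (c := c ^ 2) (w := w) h (od_pow hc) (by rw [← hw]; ring)

end N3M3

namespace N3M3

lemma od_coprime_two {x : Gi} (h : Od x) : IsCoprime x 2 := by
  have h1 : (2 : Gi) ∣ pi ^ 2 := ⟨I, by rfl⟩
  exact ((od_coprime_pi h).pow_right (n := 2)).of_isCoprime_of_dvd_right h1

lemma od3 : Od 3 := by rfl

lemma pp : pi ^ 2 = 2 * I := by rfl
lemma p4 : pi ^ 4 = -4 := by rfl

/-- the common part of the three `M` lemmas -/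
lemma ML {P e s : Gi} (hP : Od P) (hs : Od s) (hc : IsCoprime P s)
    (h : e ^ 2 = P ^ 2 + 4 * (-pi * s ^ 4)) :
    ∃ e1 e2 c d z, e1 * e2 = 1 ∧ c * d = s ∧ Od c ∧ Od d ∧ IsCoprime c d ∧
      P = e1 * c ^ 4 + pi * e2 * d ^ 4 ∧
      ((e1 = 1 ∧ e2 = 1 ∧ P = 2 + I + 8 * z) ∨ (e1 = -1 ∧ e2 = -1 ∧ P = -(2 + I) + 8 * z) ∨
       (e1 = I ∧ e2 = -I ∧ P = 1 + 8 * z) ∨ (e1 = -I ∧ e2 = I ∧ P = -1 + 8 * z)) := by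
  obtain ⟨e1, e2, c, d, he, hcd, hoc, hcop, hh⟩ := Spl 4 (by norm_num) (K := 1) (r := -pi) 1 hP
    (Or.inl rfl) (by simp) (od_ne hs) hc (by rw [h]; ring)
    (by rw [one_mul]; exact (Dvd.intro _ rfl : pi ∣ pi * (-s ^ 4)).trans (by ring_nf; exact dvd_rfl))
  have hod : Od d := by rw [← hcd] at hs; exact (od_mul.1 hs).2
  have hPe : P = e1 * c ^ 4 + pi * e2 * d ^ 4 := by
    rcases hh with hh | hh <;> rw [hh.1] <;> ring
  obtain ⟨y1, hy1⟩ := four_form hoc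
  obtain ⟨y2, hy2⟩ := four_form hod
  refine ⟨e1, e2, c, d, e1 * pi * y1 + pi * e2 * pi * y2, he, hcd, hoc, hod, hcop, hPe, ?_⟩
  have e0 : P = e1 + pi * e2 + 8 * (e1 * pi * y1 + pi * e2 * pi * y2) := by
    rw [hPe, hy1, hy2]; ring
  generalize e1 * pi * y1 + pi * e2 * pi * y2 = z at *
  rcases units_cases he with ⟨rfl, rfl⟩ | ⟨rfl, rfl⟩ | ⟨rfl, rfl⟩ | ⟨rfl, rfl⟩
  · left; refine ⟨rfl, rfl, ?_⟩; rw [e0, pi_eq]; ring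
  · right; left; refine ⟨rfl, rfl, ?_⟩; rw [e0, pi_eq]; ring
  · right; right; left; refine ⟨rfl, rfl, ?_⟩; rw [e0, pi_eq]; linear_combination -I_mul
  · right; right; right; refine ⟨rfl, rfl, ?_⟩; rw [e0, pi_eq]; linear_combination I_mul

lemma M_A {s t e : Gi} (hs : Od s) (hc : IsCoprime s t)
    (hd : (∃ t1, t = 2 * t1) ∨ (∃ z, t ^ 2 = s ^ 2 + 4 * z))
    (h : e ^ 2 = ka * s ^ 4 + 12 * s ^ 2 * t ^ 2 + 4 * t ^ 4) : False := by
  have hP : Od (3 * s ^ 2 + 2 * t ^ 2) := by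
    refine od_add_even (od_mul.2 ⟨od3, od_pow hs⟩) (pi_dvd_two.mul_right _)
  have hcP : IsCoprime (3 * s ^ 2 + 2 * t ^ 2) s := by
    have : IsCoprime s (2 * t ^ 2 + s * (3 * s)) :=
      ((od_coprime_two hs).mul_right hc.pow_right).add_mul_left_right _
    have := this.symm
    convert this using 1; ring
  obtain ⟨e1, e2, c, d, z, he, hcd, hoc, hod, hcop, hPe, hz⟩ := ML (e := e) hP hs hcP
    (by rw [h, ka_eq, pi_eq]; ring)
  clear hPe
  obtain ⟨y, hy⟩ := sq_form hs
  rcases hd with ⟨t1, rfl⟩ | ⟨w, hw⟩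
  · generalize hT : t1 ^ 2 = T at *
    have e3 : 3 * s ^ 2 + 2 * (2 * t1) ^ 2 = 3 * s ^ 2 + 8 * T := by rw [← hT]; ring
    rw [e3] at hz
    rcases hy with hy | hy <;> rw [hy] at hz <;>
    rcases hz with ⟨-, -, hz⟩ | ⟨-, -, hz⟩ | ⟨-, -, hz⟩ | ⟨-, -, hz⟩ <;>
    have h1 := re_of_eq hz <;> have h2 := im_of_eq hz <;> simp at h1 h2 <;> omega
  · rw [hw] at hz
    rcases hy with hy | hy <;> rw [hy] at hz <;>
    rcases hz with ⟨-, -, hz⟩ | ⟨-, -, hz⟩ | ⟨-, -, hz⟩ | ⟨-, -, hz⟩ <;>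
    have h1 := re_of_eq hz <;> have h2 := im_of_eq hz <;> simp at h1 h2 <;> omega

lemma M_C {s t1 e : Gi} (hs : Od s) (hc : IsCoprime s (pi * t1))
    (h : e ^ 2 = ka * s ^ 4 + 6 * (I - 1) * s ^ 2 * (pi * t1) ^ 2 + (I - 1) ^ 2 * (pi * t1) ^ 4) :
    False := by
  have hP : Od (3 * s ^ 2 + (I - 1) * (pi * t1) ^ 2) := by
    refine od_add_even (od_mul.2 ⟨od3, od_pow hs⟩) ?_
    exact ⟨(I - 1) * pi * t1 ^ 2, by ring⟩
  have hcP : IsCoprime (3 * s ^ 2 + (I - 1) * (pi * t1) ^ 2) s := by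
    have h3 : IsCoprime s (I - 1) :=
      (od_coprime_pi hs).of_isCoprime_of_dvd_right ⟨-I, by rfl⟩
    have : IsCoprime s ((I - 1) * (pi * t1) ^ 2 + s * (3 * s)) :=
      (h3.mul_right hc.pow_right).add_mul_left_right _
    have := this.symm
    convert this using 1; ring
  obtain ⟨e1, e2, c, d, z, he, hcd, hoc, hod, hcop, hPe, hz⟩ := ML (e := e) hP hs hcP
    (by rw [h, ka_eq, pi_eq]; ring)
  clear hPe
  obtain ⟨y, hy⟩ := sq_form hs
  have e3 : 3 * s ^ 2 + (I - 1) * (pi * t1) ^ 2 = 3 * s ^ 2 - 2 * pi * t1 ^ 2 := by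
    rw [pi_eq]; linear_combination (t1 ^ 2 * (I + 1)) * I_mul
  rw [e3] at hz
  by_cases ht : Od t1
  · obtain ⟨x, hx⟩ := sq_form ht
    rcases hx with hx | hx <;> rw [hx] at hz <;>
    rcases hy with hy | hy <;> rw [hy] at hz <;>
    rcases hz with ⟨-, -, hz⟩ | ⟨-, -, hz⟩ | ⟨-, -, hz⟩ | ⟨-, -, hz⟩ <;>
    have h1 := re_of_eq hz <;> have h2 := im_of_eq hz <;> simp at h1 h2 <;> omega
  · obtain ⟨x, rfl⟩ := (not_od _).1 ht
    have e4 : (pi * x) ^ 2 = 2 * I * x ^ 2 := by rw [mul_pow, pp]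
    rw [e4] at hz
    generalize x ^ 2 = X at *
    rcases hy with hy | hy <;> rw [hy] at hz <;>
    rcases hz with ⟨-, -, hz⟩ | ⟨-, -, hz⟩ | ⟨-, -, hz⟩ | ⟨-, -, hz⟩ <;>
    have h1 := re_of_eq hz <;> have h2 := im_of_eq hz <;> simp at h1 h2 <;> omega

end N3M3

namespace N3M3

lemma sq2 {x : Gi} (h : Od x) : ∃ w, x ^ 2 = 1 + 2 * w := by
  obtain ⟨y, hy | hy⟩ := sq_form h
  · exact ⟨2 * pi * y, by rw [hy]; ring⟩
  · exact ⟨-1 + 2 * pi * y, by rw [hy]; ring⟩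

/-- `η` is `1` or `I` -/
def Eta (x : Gi) : Prop := x = 1 ∨ x = I

lemma eta1 : Eta 1 := Or.inl rfl
lemma etaI : Eta I := Or.inr rfl

lemma cop_of_cop_mul {c d x : Gi} (h : IsCoprime c (x * d)) : IsCoprime c d := h.of_mul_right_right
lemma isu_I : IsUnit I := IsUnit.of_mul_eq_one (-I) (by rfl)
lemma cop_I {c d : Gi} (h : IsCoprime c d) : IsCoprime c (I * d) :=
  (isCoprime_mul_unit_left_right isu_I c d).2 h
lemma I2 : I ^ 2 = -1 := by rfl
lemma I4 : I ^ 4 = 1 := by rfl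

lemma pi_dvd_of {c d t : Gi} (hc : Od c) (h : c * d = pi * t) : ∃ b, d = pi * b ∧ c * b = t := by
  have h1 : pi ∣ c * d := ⟨t, h⟩
  rcases pi_prime.dvd_or_dvd h1 with h2 | h2
  · exact absurd h2 ((od_iff c).1 hc)
  · obtain ⟨b, rfl⟩ := h2
    refine ⟨b, rfl, ?_⟩
    apply mul_left_cancel₀ pi_ne
    rw [← h]; ring

lemma A1 {s t e : Gi} (hs : Od s) (hc : IsCoprime s t) (ht : t ≠ 0)
    (h : e ^ 2 = s ^ 4 + 12 * s ^ 2 * t ^ 2 + 4 * ka * t ^ 4) :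
    ∃ η a b, Eta η ∧ a * b = η * t ∧ Od a ∧ IsCoprime a b ∧
      (η * s) ^ 2 = a ^ 4 - 6 * a ^ 2 * b ^ 2 + 4 * pi * b ^ 4 := by
  have hP : Od (s ^ 2 + 6 * t ^ 2) :=
    od_add_even (od_pow hs) ((pi_dvd_two.mul_right (3 * t ^ 2)).trans (by ring_nf; exact dvd_rfl))
  have hcP : IsCoprime (s ^ 2 + 6 * t ^ 2) (pi * t) := by
    refine (od_coprime_pi hP).mul_right ?_
    rw [show s ^ 2 + 6 * t ^ 2 = s ^ 2 + (6 * t) * t by ring]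
    exact (hc.pow_left (m := 2)).add_mul_right_left (6 * t)
  obtain ⟨e1, e2, c, d, he, hcd, hoc, hcop, hh⟩ := Spl 4 (by norm_num) (e := e) (K := 1) (r := pi)
    1 hP (Or.inl rfl) (by simp) (mul_ne_zero pi_ne ht) hcP
    (by rw [h, ka_eq, mul_pow, p4, pi_eq]; ring)
    ((Dvd.intro _ rfl : pi ∣ pi * ((pi * t) ^ 4)).trans (by rw [one_mul]))
  obtain ⟨b, rfl, hcb⟩ := pi_dvd_of hoc hcd
  have hPe : s ^ 2 + 6 * t ^ 2 = e1 * c ^ 4 + 4 * pi * e2 * b ^ 4 := by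
    rcases hh with hh | hh <;> rw [hh.1, mul_pow, p4] <;> ring
  have hcb2 := cop_of_cop_mul hcop
  obtain ⟨w, hw⟩ := sq2 hs
  rcases upm4 (w := w + 3 * t ^ 2 - 2 * pi * e2 * b ^ 4) he hoc
    (by linear_combination hw - hPe) with ⟨rfl, rfl⟩ | ⟨rfl, rfl⟩
  · refine ⟨1, c, b, eta1, by rw [hcb, one_mul], hoc, hcb2, ?_⟩
    rw [← hcb] at hPe
    linear_combination hPe
  · refine ⟨I, c, I * b, etaI, by rw [← hcb]; ring, hoc, cop_I hcb2, ?_⟩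
    rw [← hcb] at hPe
    linear_combination (s ^ 2 + 6 * c ^ 2 * b ^ 2) * I2 - hPe - 4 * pi * b ^ 4 * I4

/-- coprimality of complementary factors -/
lemma cop {K u v b : Gi} (k : ℕ) (hK : Prime K) (hu : u ≠ 0) (hc : IsCoprime (u - v) b)
    (h : u * v = K * b ^ k) : IsCoprime u v := by
  apply isCoprime_of_prime_dvd
  · intro h5; exact hu h5.1
  · intro p hp hpu hpv
    have hpp : p * p ∣ K * b ^ k := by rw [← h]; exact mul_dvd_mul hpu hpv
    have hpz : p ∣ b ^ k := by
      rcases hp.dvd_or_dvd ((dvd_mul_right p p).trans hpp) with h6 | h6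
      · obtain ⟨w, hw⟩ := (hp.irreducible.associated_of_dvd hK.irreducible h6)
        rw [← hw, mul_assoc] at hpp
        have := (mul_dvd_mul_iff_left hp.ne_zero).1 hpp
        exact (Units.dvd_mul_left).1 this
      · exact h6
    exact hp.not_isUnit (hc.isUnit_of_dvd' (dvd_sub hpu hpv) (hp.dvd_of_dvd_pow hpz))

lemma LA0 {s t e : Gi} (hs : Od s) (ht : Od t) (hc : IsCoprime s t)
    (h : e ^ 2 = s ^ 4 + 12 * s ^ 2 * t ^ 2 + 4 * ka * t ^ 4) : False := by
  obtain ⟨η, f, g, hη, hfg, hf, hcop, h1⟩ := A1 hs hc (od_ne ht) h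
  have hoη : Od η := by rcases hη with rfl | rfl <;> rfl
  have hg : Od g := (od_mul.1 (hfg ▸ od_mul.2 ⟨hoη, ht⟩)).2
  have hoc : Od (η * s) := od_mul.2 ⟨hoη, hs⟩
  generalize η * s = c1 at *
  obtain ⟨y, hy⟩ := sq_form hoc
  obtain ⟨x, hx⟩ := sq_form hf
  obtain ⟨z, hz⟩ := sq_form hg
  have hQ : ∃ q, f ^ 2 - 3 * g ^ 2 = 4 * q := by
    have e1 : c1 ^ 2 = (f ^ 2) ^ 2 - 6 * f ^ 2 * g ^ 2 + 4 * pi * (g ^ 2) ^ 2 := by rw [h1]; ring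
    rcases hx with hx | hx <;> rcases hz with hz | hz
    · exfalso
      have e2 : c1 ^ 2 = -5 + 4 * pi + 8 * (pi * (-2 * x - 3 * z - 12 * pi * x * z + 2 * pi * x ^ 2
          + 4 * pi * z + 8 * pi ^ 2 * z ^ 2)) := by
        rw [e1, hx, hz]; ring
      rcases hy with hy | hy <;> rw [hy] at e2 <;>
      have h1 := re_of_eq e2 <;> have h2 := im_of_eq e2 <;>
      generalize pi * (-2 * x - 3 * z - 12 * pi * x * z + 2 * pi * x ^ 2
          + 4 * pi * z + 8 * pi ^ 2 * z ^ 2) = W at * <;> simp at h1 h2 <;> omega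
    · exact ⟨1 + pi * x - 3 * pi * z, by rw [hx, hz]; ring⟩
    · exact ⟨-1 + pi * x - 3 * pi * z, by rw [hx, hz]; ring⟩
    · exfalso
      have e2 : c1 ^ 2 = -5 + 4 * pi + 8 * (pi * (2 * x + 3 * z - 12 * pi * x * z + 2 * pi * x ^ 2
          - 4 * pi * z + 8 * pi ^ 2 * z ^ 2)) := by
        rw [e1, hx, hz]; ring
      rcases hy with hy | hy <;> rw [hy] at e2 <;>
      have h1 := re_of_eq e2 <;> have h2 := im_of_eq e2 <;>
      generalize pi * (2 * x + 3 * z - 12 * pi * x * z + 2 * pi * x ^ 2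
          - 4 * pi * z + 8 * pi ^ 2 * z ^ 2) = W at * <;> simp at h1 h2 <;> omega
  obtain ⟨q, hq⟩ := hQ
  have huv : (4 * q + c1) * (4 * q - c1) = ka * g ^ 4 := by
    rw [← hq, ka_eq]; rw [pi_eq] at h1; linear_combination - h1
  have hou : Od (4 * q + c1) := by
    rw [add_comm]; exact od_add_even hoc ((pi_dvd_two.mul_right (2 * q)).trans (by ring_nf; exact dvd_rfl))
  have hcg : IsCoprime c1 g := by
    have h3 : IsCoprime (c1 ^ 2) g := by
      rw [h1]
      rw [show f ^ 4 - 6 * f ^ 2 * g ^ 2 + 4 * pi * g ^ 4 =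
        f ^ 4 + (- 6 * f ^ 2 * g + 4 * pi * g ^ 3) * g by ring]
      exact (hcop.pow_left (m := 4)).add_mul_right_left _
    exact (IsCoprime.pow_left_iff (by norm_num)).1 h3
  have hcuv := cop 4 ka_irred (od_ne hou) (u := 4 * q + c1) (v := 4 * q - c1) (b := g) (by
      rw [show 4 * q + c1 - (4 * q - c1) = 2 * c1 by ring]
      exact (od_coprime_two hg).symm.mul_left hcg) huv
  have fin : ∀ e1 e2 c d : Gi, e1 * e2 = 1 → c * d = g → 8 * q = ka * e1 * c ^ 4 + e2 * d ^ 4 → False := by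
    intro e1 e2 c d he hcd hh
    rw [← hcd] at hg
    obtain ⟨y1, hy1⟩ := four_form (od_mul.1 hg).1
    obtain ⟨y2, hy2⟩ := four_form (od_mul.1 hg).2
    rw [hy1, hy2] at hh
    have hh2 : ka * e1 + e2 = 8 * (q - ka * e1 * pi * y1 - e2 * pi * y2) := by linear_combination -hh
    generalize q - ka * e1 * pi * y1 - e2 * pi * y2 = W at *
    rcases units_cases he with ⟨rfl, rfl⟩ | ⟨rfl, rfl⟩ | ⟨rfl, rfl⟩ | ⟨rfl, rfl⟩ <;>
    have h1 := re_of_eq hh2 <;> have h2 := im_of_eq hh2 <;> simp at h1 h2 <;> omega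
  rcases ka_irred.dvd_or_dvd (Dvd.intro _ huv.symm) with h6 | h6
  · obtain ⟨e1, e2, c, d, he, hu, hv, hcd⟩ := FL 4 (by norm_num) hcuv h6 (one_dvd _) ka_ne one_ne_zero
      (od_ne hg) (by rw [huv]; ring)
    exact fin e1 e2 c d he hcd (by linear_combination hu + hv)
  · obtain ⟨e1, e2, c, d, he, hu, hv, hcd⟩ := FL 4 (by norm_num) hcuv (one_dvd _) h6 one_ne_zero ka_ne
      (od_ne hg) (by rw [huv]; ring)
    exact fin e2 e1 d c (by rw [mul_comm]; exact he) (by rw [mul_comm]; exact hcd)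
      (by linear_combination hu + hv)

end N3M3

namespace N3M3

lemma two_ne : (2 : Gi) ≠ 0 := by decide
lemma four_ne : (4 : Gi) ≠ 0 := by decide

lemma pow2_dvd {a b x : Gi} (n : ℕ) (ha : Od a) (h : a * b = 2 ^ n * x) :
    ∃ b', b = 2 ^ n * b' ∧ a * b' = x := by
  have h1 : (2 : Gi) ^ n ∣ b :=
    ((od_coprime_two ha).symm.pow_left (m := n)).dvd_of_dvd_mul_left ⟨x, h⟩
  obtain ⟨b', rfl⟩ := h1
  refine ⟨b', rfl, mul_left_cancel₀ (pow_ne_zero n two_ne) ?_⟩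
  rw [← h]; ring

lemma eta_four {η : Gi} (h : Eta η) : η ^ 4 = 1 := by
  rcases h with rfl | rfl <;> rfl
lemma eta_od {η : Gi} (h : Eta η) : Od η := by
  rcases h with rfl | rfl <;> rfl

/-- transport of the direction condition -/
lemma direct {η1 η2 s t a b c d x1 x2 x3 : Gi} (hη2 : Eta η2) (hc : Od c)
    (hab : a * b = η1 * t) (hcd : c * d = η2 * b)
    (h1 : (η1 * s) ^ 2 = 1 + 4 * x1) (h2 : t ^ 2 = s ^ 2 + 4 * x2) (h3 : (η2 * a) ^ 2 = 1 + 4 * x3) :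
    ∃ z, d ^ 2 = c ^ 2 + 4 * z := by
  obtain ⟨y, hy⟩ := four_form hc
  have h4 := eta_four hη2
  have e1 : (c * d) ^ 2 * (η2 * a) ^ 2 = (η1 * s) ^ 2 + 4 * (η1 ^ 2 * x2) := by
    calc (c * d) ^ 2 * (η2 * a) ^ 2 = η2 ^ 4 * (a * b) ^ 2 := by rw [hcd]; ring
      _ = η1 ^ 2 * t ^ 2 := by rw [h4, hab]; ring
      _ = _ := by rw [h2]; ring
  rw [h1, h3] at e1
  refine ⟨(x1 + η1 ^ 2 * x2 - (c * d) ^ 2 * x3) * c ^ 2 - 2 * pi * y * d ^ 2, ?_⟩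
  linear_combination c ^ 2 * e1 - d ^ 2 * hy

lemma A2 {a b0 s1 : Gi} (ha : Od a) (hc : IsCoprime a (2 * b0)) (hb : b0 ≠ 0)
    (h : s1 ^ 2 = a ^ 4 - 6 * a ^ 2 * (2 * b0) ^ 2 + 4 * pi * (2 * b0) ^ 4) :
    ∃ η c d, Eta η ∧ c * d = η * b0 ∧ Od c ∧ IsCoprime c d ∧
      ((η * a) ^ 2 = c ^ 4 + 12 * c ^ 2 * d ^ 2 + 4 * ka * d ^ 4 ∨
       (η * a) ^ 2 = ka * c ^ 4 + 12 * c ^ 2 * d ^ 2 + 4 * d ^ 4) := by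
  have hP : Od (a ^ 2 + -12 * b0 ^ 2) :=
    od_add_even (od_pow ha) ((pi_dvd_two.mul_right (-6 * b0 ^ 2)).trans (by ring_nf; exact dvd_rfl))
  have hcP : IsCoprime (a ^ 2 + -12 * b0 ^ 2) (pi * b0) := by
    refine (od_coprime_pi hP).mul_right ?_
    rw [show a ^ 2 + -12 * b0 ^ 2 = a ^ 2 + (-12 * b0) * b0 by ring]
    exact ((cop_of_cop_mul hc).pow_left (m := 2)).add_mul_right_left _
  obtain ⟨e1, e2, c, d, he, hcd, hoc, hcop, hh⟩ := Spl 4 (by norm_num) (e := s1) (K := ka) (r := 1)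
    1 hP (Or.inr ka_irred) (by simp) (mul_ne_zero pi_ne hb) hcP
    (by rw [h, ka_eq, mul_pow pi, p4, pi_eq]; ring)
    ((Dvd.intro _ rfl : pi ∣ pi * (ka * pi ^ 3 * b0 ^ 4)).trans (by ring_nf; exact dvd_rfl))
  obtain ⟨b, rfl, hcb⟩ := pi_dvd_of hoc hcd
  rw [mul_pow, p4] at hh
  have hcb2 := cop_of_cop_mul hcop
  obtain ⟨w, hw⟩ := sq2 ha
  rcases hh with ⟨hh, -⟩ | ⟨hh, -⟩
  · rcases upm4 (w := w - 6 * b0 ^ 2 - 2 * ka * e2 * b ^ 4) he hoc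
      (by linear_combination hw - hh) with ⟨rfl, rfl⟩ | ⟨rfl, rfl⟩
    · refine ⟨1, c, b, eta1, by rw [hcb, one_mul], hoc, hcb2, Or.inl ?_⟩
      rw [← hcb] at hh
      linear_combination hh
    · refine ⟨I, c, I * b, etaI, by rw [← hcb]; ring, hoc, cop_I hcb2, Or.inl ?_⟩
      rw [← hcb] at hh
      linear_combination (a ^ 2 - 12 * c ^ 2 * b ^ 2) * I2 - hh - 4 * ka * b ^ 4 * I4
  · obtain ⟨w2, hw2⟩ := sq2 (od_pow (n := 2) hoc)
    have hka : ka = 1 + 4 * (1 - I) := by rfl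
    rcases upm4 (w := w - 6 * b0 ^ 2 - 2 * e2 * b ^ 4 - 2 * (1 - I) * e1 * c ^ 4) he hoc
      (by rw [hka] at hh; linear_combination hw - hh) with ⟨rfl, rfl⟩ | ⟨rfl, rfl⟩
    · refine ⟨1, c, b, eta1, by rw [hcb, one_mul], hoc, hcb2, Or.inr ?_⟩
      rw [← hcb] at hh
      linear_combination hh
    · refine ⟨I, c, I * b, etaI, by rw [← hcb]; ring, hoc, cop_I hcb2, Or.inr ?_⟩
      rw [← hcb] at hh
      linear_combination (a ^ 2 - 12 * c ^ 2 * b ^ 2) * I2 - hh - 4 * b ^ 4 * I4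

lemma eta_ne {η : Gi} (h : Eta η) : η ≠ 0 := od_ne (eta_od h)

lemma LA : ∀ (j : ℕ) {s t e z : Gi}, Od s → Od t → IsCoprime s (2 ^ (j + 1) * t) →
    t ^ 2 = s ^ 2 + 4 * z →
    e ^ 2 = s ^ 4 + 12 * s ^ 2 * (2 ^ (j + 1) * t) ^ 2 + 4 * ka * (2 ^ (j + 1) * t) ^ 4 → False := by
  intro j
  induction j with
  | zero =>
    intro s t e z hs ht hc hz h
    obtain ⟨η1, a, b, hη1, hab, ha, hcop, h1⟩ := A1 hs hc
      (mul_ne_zero (pow_ne_zero _ two_ne) (od_ne ht)) h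
    obtain ⟨b', rfl, hab'⟩ := pow2_dvd (0 + 1) (x := η1 * t) ha (by rw [hab]; ring)
    have hb' : Od b' := (od_mul.1 (hab' ▸ od_mul.2 ⟨eta_od hη1, ht⟩)).2
    rw [show (0 + 1 : ℕ) = 1 by rfl, pow_one] at *
    obtain ⟨η2, c, d, hη2, hcd, hoc, hcop2, h2⟩ := A2 ha hcop (od_ne hb') h1
    have hd : Od d := (od_mul.1 (hcd ▸ od_mul.2 ⟨eta_od hη2, hb'⟩)).2
    obtain ⟨y1, hy1⟩ := four_form ha
    obtain ⟨y2, hy2⟩ := four_form hoc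
    rcases h2 with h2 | h2
    · exact LA0 hoc hd hcop2 h2
    · obtain ⟨z', hz'⟩ := direct (x1 := 2 * pi * y1 - 6 * a ^ 2 * b' ^ 2 + 16 * pi * b' ^ 4)
        (x2 := z) (x3 := ka * 2 * pi * y2 + 3 * c ^ 2 * d ^ 2 + d ^ 4 + (1 - I)) hη2 hoc hab' hcd
        (by rw [h1, hy1]; ring) hz (by rw [h2, hy2, ka_eq]; ring)
      exact M_A hoc hcop2 (Or.inr ⟨z', hz'⟩) h2
  | succ j ih =>
    intro s t e z hs ht hc hz h
    obtain ⟨η1, a, b, hη1, hab, ha, hcop, h1⟩ := A1 hs hc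
      (mul_ne_zero (pow_ne_zero _ two_ne) (od_ne ht)) h
    obtain ⟨b', rfl, hab'⟩ := pow2_dvd (j + 1 + 1) (x := η1 * t) ha (by rw [hab]; ring)
    have hb' : Od b' := (od_mul.1 (hab' ▸ od_mul.2 ⟨eta_od hη1, ht⟩)).2
    rw [pow_succ _ (j + 1), mul_comm _ (2 : Gi), mul_assoc (2 : Gi)] at h1 hcop
    obtain ⟨η2, c, d, hη2, hcd, hoc, hcop2, h2⟩ := A2 ha hcop
      (mul_ne_zero (pow_ne_zero _ two_ne) (od_ne hb')) h1
    obtain ⟨d', rfl, hcd'⟩ := pow2_dvd (j + 1) (x := η2 * b') hoc (by rw [hcd]; ring)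
    have hd : Od d' := (od_mul.1 (hcd' ▸ od_mul.2 ⟨eta_od hη2, hb'⟩)).2
    obtain ⟨y1, hy1⟩ := four_form ha
    obtain ⟨y2, hy2⟩ := four_form hoc
    rcases h2 with h2 | h2
    · obtain ⟨z', hz'⟩ := direct (x1 := 2 * pi * y1 - 6 * a ^ 2 * (2 ^ (j + 1) * b') ^ 2
          + 16 * pi * (2 ^ (j + 1) * b') ^ 4)
        (x2 := z) (x3 := 2 * pi * y2 + 3 * c ^ 2 * (2 ^ (j + 1) * d') ^ 2
          + ka * (2 ^ (j + 1) * d') ^ 4) hη2 hoc hab' hcd'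
        (by rw [h1, hy1]; ring) hz (by rw [h2, hy2]; ring)
      exact ih hoc hd hcop2 hz' h2
    · refine M_A hoc hcop2 (Or.inl ⟨2 ^ j * d', by ring⟩) h2

end N3M3

namespace N3M3

lemma beta2 : (I - 1) ^ 2 = -(2 * I) := by rfl
lemma pi3 : pi ^ 3 = 2 * (I - 1) := by rfl

lemma C1 {s t e : Gi} (hs : Od s) (hc : IsCoprime s (pi * t)) (ht : t ≠ 0)
    (h : e ^ 2 = s ^ 4 + 6 * (I - 1) * s ^ 2 * (pi * t) ^ 2 + (I - 1) ^ 2 * ka * (pi * t) ^ 4) :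
    ∃ e1 e2 a b, e1 * e2 = 1 ∧ a * b = t ∧ Od a ∧ IsCoprime a (pi * b) ∧
      s ^ 2 + 3 * (I - 1) * (pi * t) ^ 2 = e1 * a ^ 4 - pi ^ 3 * e2 * (pi * b) ^ 4 := by
  have hP : Od (s ^ 2 + 3 * (I - 1) * (pi * t) ^ 2) :=
    od_add_even (od_pow hs) (⟨3 * (I - 1) * pi * t ^ 2, by ring⟩)
  have hcP : IsCoprime (s ^ 2 + 3 * (I - 1) * (pi * t) ^ 2) (pi * t) := by
    rw [show s ^ 2 + 3 * (I - 1) * (pi * t) ^ 2 = s ^ 2 + (3 * (I - 1) * (pi * t)) * (pi * t) by ring]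
    exact (hc.pow_left (m := 2)).add_mul_right_left _
  obtain ⟨e1, e2, c, d, he, hcd, hoc, hcop, hh⟩ := Spl 4 (by norm_num) (e := e) (K := 1)
    (r := pi ^ 3) 3 hP (Or.inl rfl) dvd_rfl (mul_ne_zero pi_ne ht) hcP
    (by
      rw [h, pi3]
      have e1 : (I - 1) ^ 2 * ka = 9 * (I - 1) ^ 2 + 4 * (2 * (I - 1)) := by rfl
      rw [e1]; ring)
    ⟨pi ^ 2 * (pi * t) ^ 4, by ring⟩
  obtain ⟨b, rfl, hcb⟩ := pi_dvd_of hoc hcd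
  refine ⟨e1, e2, c, b, he, hcb, hoc, hcop, ?_⟩
  rcases hh with hh | hh <;> rw [hh.1] <;> ring

lemma C1' {s t e : Gi} (hs : Od s) (hc : IsCoprime s (pi * t)) (ht : t ≠ 0)
    (h : e ^ 2 = s ^ 4 + 6 * (I - 1) * s ^ 2 * (pi * t) ^ 2 + (I - 1) ^ 2 * ka * (pi * t) ^ 4) :
    ∃ η a b, Eta η ∧ a * b = η * t ∧ Od a ∧ IsCoprime a (pi * b) ∧
      (η * s) ^ 2 = a ^ 4 - 3 * (I - 1) * a ^ 2 * (pi * b) ^ 2 - pi ^ 3 * (pi * b) ^ 4 := by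
  obtain ⟨e1, e2, c, b, he, hcb, hoc, hcop, hh⟩ := C1 hs hc ht h
  obtain ⟨w, hw⟩ := sq2 hs
  have hpi : pi ^ 2 = 2 * I := pp
  rcases upm4 (w := w + 3 * (I - 1) * I * t ^ 2 + (I - 1) * e2 * (pi * b) ^ 4) he hoc
    (by rw [pi3] at hh; linear_combination hw - hh + 3 * (I - 1) * t ^ 2 * hpi)
    with ⟨rfl, rfl⟩ | ⟨rfl, rfl⟩
  · refine ⟨1, c, b, eta1, by rw [hcb, one_mul], hoc, hcop, ?_⟩
    rw [← hcb] at hh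
    linear_combination hh
  · refine ⟨I, c, I * b, etaI, by rw [← hcb]; ring, hoc, ?_, ?_⟩
    · have := cop_I hcop
      rwa [show I * (pi * b) = pi * (I * b) by ring] at this
    rw [← hcb] at hh
    generalize hX : (pi * b) = X at *
    have e1 : (pi * (I * b)) ^ 2 = - X ^ 2 := by
      rw [← hX]; linear_combination (pi * b) ^ 2 * I2
    have e2 : (pi * (I * b)) ^ 4 = X ^ 4 := by
      rw [← hX]; linear_combination (pi * b) ^ 4 * I4
    rw [e1, e2]
    rw [show pi * (c * b) = c * X by rw [← hX]; ring] at hh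
    linear_combination s ^ 2 * I2 - hh

lemma C2 {a b0 s1 : Gi} (ha : Od a) (hc : IsCoprime a (2 * (pi * b0))) (hb : b0 ≠ 0)
    (h : s1 ^ 2 = a ^ 4 - 3 * (I - 1) * a ^ 2 * (2 * (pi * b0)) ^ 2 - pi ^ 3 * (2 * (pi * b0)) ^ 4) :
    ∃ η c d, Eta η ∧ c * d = η * b0 ∧ Od c ∧ IsCoprime c (pi * d) ∧
      ((η * a) ^ 2 = c ^ 4 + 6 * (I - 1) * c ^ 2 * (pi * d) ^ 2 + (I - 1) ^ 2 * ka * (pi * d) ^ 4 ∨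
       (η * a) ^ 2 = ka * c ^ 4 + 6 * (I - 1) * c ^ 2 * (pi * d) ^ 2 + (I - 1) ^ 2 * (pi * d) ^ 4) := by
  have hP : Od (a ^ 2 + -6 * (I - 1) * (pi * b0) ^ 2) :=
    od_add_even (od_pow ha) (⟨-6 * (I - 1) * pi * b0 ^ 2, by ring⟩)
  have hcP : IsCoprime (a ^ 2 + -6 * (I - 1) * (pi * b0) ^ 2) (pi * b0) := by
    rw [show a ^ 2 + -6 * (I - 1) * (pi * b0) ^ 2 =
      a ^ 2 + (-6 * (I - 1) * (pi * b0)) * (pi * b0) by ring]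
    exact ((cop_of_cop_mul hc).pow_left (m := 2)).add_mul_right_left _
  obtain ⟨e1, e2, c, d, he, hcd, hoc, hcop, hh⟩ := Spl 4 (by norm_num) (e := s1) (K := ka)
    (r := pi ^ 2) 2 hP (Or.inr ka_irred) dvd_rfl (mul_ne_zero pi_ne hb) hcP
    (by
      rw [h, pi3]
      have e1 : 4 * (ka * pi ^ 2) = -16 * (2 * (I - 1)) - 36 * (I - 1) ^ 2 := by rfl
      linear_combination - (pi * b0) ^ 4 * e1)
    ⟨ka * pi * (pi * b0) ^ 4, by ring⟩
  obtain ⟨b, rfl, hcb⟩ := pi_dvd_of hoc hcd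
  obtain ⟨w, hw⟩ := sq2 ha
  have hX2 : (pi * b0) ^ 2 = 2 * (I * b0 ^ 2) := by rw [mul_pow, pp]; ring
  have hpi : pi ^ 2 = 2 * I := pp
  have hpb : (pi * (I * b)) = I * (pi * b) := by ring
  have e3 : (I * (pi * b)) ^ 2 = - (pi * b) ^ 2 := by
    linear_combination (pi * b) ^ 2 * I2
  have e4 : (I * (pi * b)) ^ 4 = (pi * b) ^ 4 := by
    linear_combination (pi * b) ^ 4 * I4
  have hb3 : pi * b0 = c * (pi * b) := by rw [← hcb]; ring
  rcases hh with ⟨hh, -⟩ | ⟨hh, -⟩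
  · rcases upm4 (w := w - 6 * (I - 1) * (I * b0 ^ 2) + ka * I * e2 * (pi * b) ^ 4) he hoc
      (by linear_combination hw - hh - 6 * (I - 1) * hX2 + ka * e2 * (pi * b) ^ 4 * hpi)
      with ⟨rfl, rfl⟩ | ⟨rfl, rfl⟩
    · refine ⟨1, c, b, eta1, by rw [hcb, one_mul], hoc, hcop, Or.inl ?_⟩
      rw [hb3, pp] at hh
      rw [beta2]
      linear_combination hh
    · refine ⟨I, c, I * b, etaI, by rw [← hcb]; ring, hoc, by rw [hpb]; exact cop_I hcop, Or.inl ?_⟩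
      rw [hb3, pp] at hh
      rw [beta2, hpb, e3, e4]
      linear_combination (a ^ 2) * I2 - hh
  · have hka : ka = 1 + 4 * (1 - I) := by rfl
    rcases upm4 (w := w - 6 * (I - 1) * (I * b0 ^ 2) + I * e2 * (pi * b) ^ 4
      - 2 * (1 - I) * e1 * c ^ 4) he hoc
      (by rw [hka] at hh
          linear_combination hw - hh - 6 * (I - 1) * hX2 + e2 * (pi * b) ^ 4 * hpi)
      with ⟨rfl, rfl⟩ | ⟨rfl, rfl⟩
    · refine ⟨1, c, b, eta1, by rw [hcb, one_mul], hoc, hcop, Or.inr ?_⟩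
      rw [hb3, pp] at hh
      rw [beta2]
      linear_combination hh
    · refine ⟨I, c, I * b, etaI, by rw [← hcb]; ring, hoc, by rw [hpb]; exact cop_I hcop, Or.inr ?_⟩
      rw [hb3, pp] at hh
      rw [beta2, hpb, e3, e4]
      linear_combination (a ^ 2) * I2 - hh

lemma LC : ∀ (l : ℕ) {s t e : Gi}, Od s → Od t → IsCoprime s (pi * (2 ^ l * t)) →
    e ^ 2 = s ^ 4 + 6 * (I - 1) * s ^ 2 * (pi * (2 ^ l * t)) ^ 2
      + (I - 1) ^ 2 * ka * (pi * (2 ^ l * t)) ^ 4 → False := by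
  intro l
  induction l with
  | zero =>
    intro s t e hs ht hc h
    rw [pow_zero, one_mul] at *
    obtain ⟨e1, e2, a, b, he, hab, ha, hcop, h1⟩ := C1 hs hc (od_ne ht) h
    obtain ⟨y, hy⟩ := sq_form hs
    obtain ⟨x, hx⟩ := sq_form ht
    obtain ⟨y1, hy1⟩ := four_form ha
    rw [mul_pow pi t, mul_pow pi b, pp, p4, hy1] at h1
    have h2 : s ^ 2 + 6 * I * (I - 1) * t ^ 2 = e1 +
      4 * (2 * pi * e1 * y1 + pi ^ 3 * e2 * b ^ 4) := by linear_combination h1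
    generalize (2 * pi * e1 * y1 + pi ^ 3 * e2 * b ^ 4) = W at *
    rcases hy with hy | hy <;> rcases hx with hx | hx <;> rw [hx, hy] at h2 <;>
    rcases units_cases he with ⟨rfl, rfl⟩ | ⟨rfl, rfl⟩ | ⟨rfl, rfl⟩ | ⟨rfl, rfl⟩ <;>
    have h3 := re_of_eq h2 <;> have h4 := im_of_eq h2 <;> simp at h3 h4 <;> omega
  | succ l ih =>
    intro s t e hs ht hc h
    obtain ⟨η1, a, b, hη1, hab, ha, hcop, h1⟩ := C1' hs hc
      (mul_ne_zero (pow_ne_zero _ two_ne) (od_ne ht)) h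
    obtain ⟨b', rfl, hab'⟩ := pow2_dvd (l + 1) (x := η1 * t) ha (by rw [hab]; ring)
    have hb' : Od b' := (od_mul.1 (hab' ▸ od_mul.2 ⟨eta_od hη1, ht⟩)).2
    rw [show pi * (2 ^ (l + 1) * b') = 2 * (pi * (2 ^ l * b')) by ring] at h1 hcop
    obtain ⟨η2, c, d, hη2, hcd, hoc, hcop2, h2⟩ := C2 ha hcop
      (mul_ne_zero (pow_ne_zero _ two_ne) (od_ne hb')) h1
    rcases h2 with h2 | h2
    · obtain ⟨d', rfl, hcd'⟩ := pow2_dvd l (x := η2 * b') hoc (by rw [hcd]; ring)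
      have hd : Od d' := (od_mul.1 (hcd' ▸ od_mul.2 ⟨eta_od hη2, hb'⟩)).2
      exact ih hoc hd hcop2 h2
    · exact M_C hoc hcop2 h2

end N3M3

namespace N3M3

lemma N_fin {e1 e2 e1' e2' s1 s3 W : Gi} (he : e1 * e2 = 1) (he' : e1' * e2' = 1)
    (hs1 : s1 = 1 ∨ s1 = -1) (hs3 : s3 = 1 ∨ s3 = -1)
    (E3 : e1 * s1 + 2 * e2 - e1' * s3 + 2 * pi * e2' = 4 * W) : False := by
  rcases units_cases he with ⟨rfl, rfl⟩ | ⟨rfl, rfl⟩ | ⟨rfl, rfl⟩ | ⟨rfl, rfl⟩ <;>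
  rcases units_cases he' with ⟨rfl, rfl⟩ | ⟨rfl, rfl⟩ | ⟨rfl, rfl⟩ | ⟨rfl, rfl⟩ <;>
  rcases hs1 with rfl | rfl <;> rcases hs3 with rfl | rfl <;>
  have F1 := re_of_eq E3 <;> have F2 := im_of_eq E3 <;>
  simp at F1 F2 <;> omega

lemma N_core {f g x D δ : Gi} (hx : Od x) (hD : Od D) (hc : IsCoprime x D)
    (hδ : δ = 1 ∨ δ = -1) (h1 : x ^ 2 - 8 * D ^ 2 = δ * f ^ 2)
    (h2 : (x + 4 * (I - 1) * D) ^ 2 + 8 * pi * D ^ 2 = δ * g ^ 2) : False := by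
  have hsq : ∃ η, η ^ 2 = δ := by
    rcases hδ with rfl | rfl
    · exact ⟨1, by ring⟩
    · exact ⟨I, I2⟩
  obtain ⟨η, rfl⟩ := hsq
  have hX : Od (x + 4 * (I - 1) * D) :=
    od_add_even hx ((pi_dvd_two.mul_right (2 * (I - 1) * D)).trans (by ring_nf; exact dvd_rfl))
  have hcX : IsCoprime (x + 4 * (I - 1) * D) D := hc.add_mul_right_left _
  have hpD : (pi * D) ^ 2 = 2 * I * D ^ 2 := by rw [mul_pow, pp]
  obtain ⟨e1, e2, c, d, he, hcd, hoc, hcop, hh⟩ := Spl 2 (by norm_num) (e := η * f) (K := 1)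
    (r := I) 0 hx (Or.inl rfl) (isu_I.dvd) (mul_ne_zero pi_ne (od_ne hD))
    ((od_coprime_pi hx).mul_right hc)
    (by rw [hpD]; linear_combination -h1 - 8 * D ^ 2 * I2)
    ⟨I * pi * D ^ 2, by ring⟩
  obtain ⟨d1, rfl, hcd1⟩ := pi_dvd_of hoc hcd
  obtain ⟨e1', e2', c', d', he', hcd', hoc', hcop', hh'⟩ := Spl 2 (by norm_num) (e := η * g) (K := 1)
    (r := -I * pi) 1 hX (Or.inl rfl) ⟨I, by rfl⟩ (mul_ne_zero pi_ne (od_ne hD))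
    ((od_coprime_pi hX).mul_right hcX)
    (by rw [hpD]; linear_combination -h2 + 8 * pi * D ^ 2 * I2)
    ⟨-I * (pi * D) ^ 2, by ring⟩
  obtain ⟨d2, rfl, hcd2⟩ := pi_dvd_of hoc' hcd'
  have hd1 : Od d1 := (od_mul.1 (hcd1 ▸ hD)).2
  have hd2 : Od d2 := (od_mul.1 (hcd2 ▸ hD)).2
  have E1 : x = e1 * c ^ 2 + 2 * e2 * d1 ^ 2 := by
    rcases hh with ⟨hh, -⟩ | ⟨hh, -⟩ <;> rw [hh, mul_pow, pp] <;>
    linear_combination -2 * e2 * d1 ^ 2 * I2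
  have E2 : x + 4 * (I - 1) * D = e1' * c' ^ 2 - 2 * pi * e2' * d2 ^ 2 := by
    rcases hh' with ⟨hh, -⟩ | ⟨hh, -⟩ <;> rw [hh, mul_pow, pp] <;>
    linear_combination 2 * pi * e2' * d2 ^ 2 * I2
  rw [E1] at E2
  obtain ⟨y1, hy1⟩ := sq_form hoc
  obtain ⟨z2, hz2⟩ := sq2 hd1
  obtain ⟨y3, hy3⟩ := sq_form hoc'
  obtain ⟨z4, hz4⟩ := sq2 hd2
  have norm : ∀ {X Y : Gi}, (X = 1 + 4 * pi * Y ∨ X = -1 + 4 * pi * Y) →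
      ∃ s Z : Gi, (s = 1 ∨ s = -1) ∧ X = s + 4 * Z := by
    rintro X Y (h | h)
    · exact ⟨1, pi * Y, Or.inl rfl, by rw [h]; ring⟩
    · exact ⟨-1, pi * Y, Or.inr rfl, by rw [h]; ring⟩
  obtain ⟨s1, z1, hs1, hz1⟩ := norm hy1
  obtain ⟨s3, z3, hs3, hz3⟩ := norm hy3
  rw [hz1, hz2, hz3, hz4] at E2
  have E3 : e1 * s1 + 2 * e2 - e1' * s3 + 2 * pi * e2' =
    4 * (-(e1 * z1) - e2 * z2 - (I - 1) * D + e1' * z3 - pi * e2' * z4) := by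
    linear_combination E2
  exact N_fin he he' hs1 hs3 E3

end N3M3

namespace N3M3

lemma red (s t : Gi) (hs : s ≠ 0) : ∃ γ s' t', s = γ * s' ∧ t = γ * t' ∧ IsCoprime s' t' ∧ γ ≠ 0 := by
  obtain ⟨s', hs'⟩ := EuclideanDomain.gcd_dvd_left s t
  obtain ⟨t', ht'⟩ := EuclideanDomain.gcd_dvd_right s t
  have h := EuclideanDomain.gcd_eq_gcd_ab s t
  generalize EuclideanDomain.gcd s t = γ at *
  have hγ : γ ≠ 0 := by rintro rfl; apply hs; rw [hs', zero_mul]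
  refine ⟨γ, s', t', hs', ht', ⟨EuclideanDomain.gcdA s t, EuclideanDomain.gcdB s t, ?_⟩, hγ⟩
  generalize EuclideanDomain.gcdA s t = A at *
  generalize EuclideanDomain.gcdB s t = B at *
  apply mul_left_cancel₀ hγ
  calc γ * (A * s' + B * t') = (γ * s') * A + (γ * t') * B := by ring
    _ = s * A + t * B := by rw [← hs', ← ht']
    _ = γ * 1 := by rw [← h, mul_one]

lemma sq_div {γ e X : Gi} (hγ : γ ≠ 0) (h : e ^ 2 = γ ^ 4 * X) : ∃ e', e' ^ 2 = X := by
  have h1 : γ ^ 2 ∣ e := by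
    rw [← UniqueFactorizationMonoid.pow_dvd_pow_iff_dvd (n := 2) (by norm_num)]
    exact ⟨X, by rw [h]; ring⟩
  obtain ⟨e', rfl⟩ := h1
  refine ⟨e', mul_left_cancel₀ (pow_ne_zero 4 hγ) ?_⟩
  rw [← h]; ring

lemma ka_not_sq {A B σ : Gi} (hB : B ≠ 0) (hσ : σ = 1 ∨ σ = -1)
    (h : ka * A ^ 2 = σ * B ^ 2) : False := by
  obtain ⟨γ, B', A', rfl, rfl, hc, hγ⟩ := red B A hB
  have h1 : ka * A' ^ 2 = σ * B' ^ 2 := by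
    apply mul_left_cancel₀ (pow_ne_zero 2 hγ); linear_combination h
  have h2 : ka ∣ B' := by
    apply ka_irred.dvd_of_dvd_pow (n := 2)
    refine ⟨σ * A' ^ 2, ?_⟩
    rcases hσ with rfl | rfl
    · linear_combination -h1
    · linear_combination h1
  obtain ⟨B2, rfl⟩ := h2
  have h3 : ka ∣ A' := by
    apply ka_irred.dvd_of_dvd_pow (n := 2)
    refine ⟨σ * B2 ^ 2, ?_⟩
    apply mul_left_cancel₀ ka_ne
    linear_combination h1
  exact ka_irred.not_isUnit (hc.isUnit_of_dvd' (dvd_mul_right _ _) h3)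

lemma N_half {f g x D : Gi} (hf : Od f) (hfg : IsCoprime f g)
    (hx : Od x) (hD : Od D)
    (h : f ^ 2 * ((x + 4 * (I - 1) * D) ^ 2 + 8 * pi * D ^ 2) = g ^ 2 * (x ^ 2 - 8 * D ^ 2)) :
    ∃ γ σ, (σ = 1 ∨ σ = -1) ∧ x ^ 2 - 8 * D ^ 2 = σ * ka * γ ^ 2 * f ^ 2 := by
  obtain ⟨γ, x', D', rfl, rfl, hc, hγ⟩ := red x D (od_ne hx)
  have hx' := (od_mul.1 hx).2
  have hD' := (od_mul.1 hD).2
  have h1 : f ^ 2 * ((x' + 4 * (I - 1) * D') ^ 2 + 8 * pi * D' ^ 2) =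
      g ^ 2 * (x' ^ 2 - 8 * D' ^ 2) := by
    apply mul_left_cancel₀ (pow_ne_zero 2 hγ); linear_combination h
  have h2 : f ^ 2 ∣ x' ^ 2 - 8 * D' ^ 2 :=
    (IsCoprime.pow hfg : IsCoprime (f ^ 2) (g ^ 2)).dvd_of_dvd_mul_left ⟨_, h1.symm⟩
  obtain ⟨δ, hδ⟩ := h2
  have h3 : (x' + 4 * (I - 1) * D') ^ 2 + 8 * pi * D' ^ 2 = δ * g ^ 2 := by
    apply mul_left_cancel₀ (pow_ne_zero 2 (od_ne hf)); rw [h1, hδ]; ring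
  have hod : Od δ := by
    have : Od (x' ^ 2 + -8 * D' ^ 2) :=
      od_add_even (od_pow hx') ((pi_dvd_two.mul_right (-4 * D' ^ 2)).trans (by ring_nf; exact dvd_rfl))
    rw [show x' ^ 2 + -8 * D' ^ 2 = f ^ 2 * δ by rw [← hδ]; ring] at this
    exact (od_mul.1 this).2
  have hc1 : IsCoprime δ D' := by
    have h4 : IsCoprime (x' ^ 2 + (-8 * D') * D') D' := (hc.pow_left (m := 2)).add_mul_right_left _
    rw [show x' ^ 2 + (-8 * D') * D' = f ^ 2 * δ by rw [← hδ]; ring] at h4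
    exact h4.of_mul_left_right
  have hp3 := pi3
  have hY : IsCoprime δ (pi ^ 3 * D') := (od_coprime_pi hod).pow_right.mul_right hc1
  have e8 : (pi ^ 3) ^ 2 = -8 * I := by rfl
  have hd1 : δ ∣ 4 * x' + (3 + 2 * I) * (pi ^ 3 * D') := by
    apply hY.dvd_of_dvd_mul_left
    refine ⟨g ^ 2 - f ^ 2, ?_⟩
    rw [pi3] at *
    rw [pi_eq] at h3
    linear_combination h3 - hδ + (4 * D' ^ 2) * (2 * I + 1) * I2 - 24 * D' ^ 2 * I2
  have hd2 : δ ∣ ka := by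
    have h5 : δ ∣ ka * (pi ^ 3 * D') ^ 2 := by
      obtain ⟨k, hk⟩ := hd1
      have e5 : 16 * x' ^ 2 = (δ * k - (3 + 2 * I) * (pi ^ 3 * D')) ^ 2 := by rw [← hk]; ring
      refine ⟨16 * f ^ 2 - δ * k ^ 2 + 2 * k * (3 + 2 * I) * (pi ^ 3 * D'), ?_⟩
      have e6 : (3 + 2 * I) ^ 2 = ka + 16 * I := by rfl
      linear_combination 16 * hδ - e5 - (pi ^ 3 * D') ^ 2 * e6 - 16 * I * D' ^ 2 * e8 + 128 * D' ^ 2 * I2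
    exact (hY.pow_right (n := 2)).dvd_of_dvd_mul_right h5
  obtain ⟨w, hw⟩ := sq2 hx'
  obtain ⟨wf, hwf⟩ := sq2 hf
  rcases ka_irred.irreducible.dvd_iff.1 hd2 with h6 | h6
  · exfalso
    obtain ⟨e', he'⟩ := h6.exists_right_inv
    refine N_core hx' hD' hc ?_ (by rw [hδ]; ring) h3
    rcases upm (w := w - 4 * D' ^ 2) he' hf (by linear_combination hw - hδ) with h7 | h7
    · exact Or.inl h7.1
    · exact Or.inr h7.1
  · obtain ⟨u, hu⟩ := h6
    have he' : (u : Gi) * ↑u⁻¹ = 1 := u.mul_inv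
    have hka : ka = 1 + 4 * (1 - I) := by rfl
    have h9 : (u : Gi) = 1 ∨ (u : Gi) = -1 := by
      rw [← hu] at hδ
      generalize (u : Gi) = U at *
      rcases upm (w := w - 4 * D' ^ 2 - 2 * (1 - I) * f ^ 2 * U) he' hf (by
        rw [hka] at hδ; linear_combination hw - hδ) with h7 | h7
      · exact Or.inl h7.1
      · exact Or.inr h7.1
    refine ⟨γ, u, h9, ?_⟩
    rw [← hu] at hδ
    linear_combination γ ^ 2 * hδ

lemma N {f g τ y : Gi} (hf : Od f) (hg : Od g) (hτ : Od τ) (hfg : IsCoprime f g)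
    (hy : τ ^ 2 = -1 + 4 * y) (h : 4 * τ ^ 2 = (1 - I) * f ^ 4 + 3 * f ^ 2 * g ^ 2 + I * g ^ 4) :
    False := by
  obtain ⟨yf, hyf⟩ := four_form hf
  obtain ⟨yg, hyg⟩ := four_form hg
  have h3 : ∃ z, g ^ 2 * f ^ 2 = 1 + 8 * z := by
    refine ⟨3 * (2 * y - (1 - I) * pi * yf - I * pi * yg) - 2 - g ^ 2 * f ^ 2, ?_⟩
    rw [hy, hyf, hyg] at h
    linear_combination -3 * h
  obtain ⟨z, hz⟩ := h3
  have hΔ : ∃ Δ, g ^ 2 = f ^ 2 + 8 * Δ := by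
    refine ⟨f ^ 2 * z - pi * yf * g ^ 2, ?_⟩
    linear_combination f ^ 2 * hz - g ^ 2 * hyf
  obtain ⟨Δ, hΔ⟩ := hΔ
  have h4 : τ ^ 2 - f ^ 4 = 2 * Δ * ((3 + 2 * I) * f ^ 2 + 8 * I * Δ) := by
    apply mul_left_cancel₀ four_ne
    have : g ^ 4 = (f ^ 2 + 8 * Δ) ^ 2 := by rw [← hΔ]; ring
    rw [this, hΔ] at h
    linear_combination h
  have hoM : Od (Δ * ((3 + 2 * I) * f ^ 2 + 8 * I * Δ)) := by
    have h5 : Δ * ((3 + 2 * I) * f ^ 2 + 8 * I * Δ) = -1 + pi * ((1 - I) * (y - 2 * pi * yf)) := by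
      apply mul_left_cancel₀ two_ne
      rw [← mul_assoc pi, ← two_eq]
      linear_combination - h4 + hy - hyf
    rw [h5]
    exact od_add_even (by rfl) (dvd_mul_right _ _)
  have hoΔ := (od_mul.1 hoM).1
  obtain ⟨x, hx⟩ := od_sub_od hτ (od_pow (n := 2) hf)
  obtain ⟨x', hx'⟩ := od_sub_od (x := -τ) (y := f ^ 2)
    (by unfold Od at *; simp; omega) (od_pow (n := 2) hf)
  have hxx : x * x' = I * (Δ * ((3 + 2 * I) * f ^ 2 + 8 * I * Δ)) := by
    apply mul_left_cancel₀ (pow_ne_zero 2 pi_ne)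
    calc pi ^ 2 * (x * x') = (pi * x) * (pi * x') := by ring
      _ = -(τ ^ 2 - f ^ 4) := by rw [← hx, ← hx']; ring
      _ = _ := by rw [h4, pp]; linear_combination (-2 * Δ * ((3 + 2 * I) * f ^ 2 + 8 * I * Δ)) * I2
  have hoxx : Od (x * x') := by rw [hxx]; exact od_mul.2 ⟨by rfl, hoM⟩
  have hsum : x + x' = -(1 - I) * f ^ 2 := by
    apply mul_left_cancel₀ pi_ne
    calc pi * (x + x') = pi * x + pi * x' := by ring
      _ = - (2 * f ^ 2) := by rw [← hx, ← hx']; ring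
      _ = _ := by rw [two_eq]; ring
  have hq : ∀ {X X' : Gi}, X + X' = -(1 - I) * f ^ 2 →
      X * X' = I * (Δ * ((3 + 2 * I) * f ^ 2 + 8 * I * Δ)) →
      f ^ 2 * ((X + 4 * (I - 1) * Δ) ^ 2 + 8 * pi * Δ ^ 2) = g ^ 2 * (X ^ 2 - 8 * Δ ^ 2) := by
    intro X X' hs hp
    have e1 : X ^ 2 + (1 - I) * f ^ 2 * X + I * (Δ * ((3 + 2 * I) * f ^ 2 + 8 * I * Δ)) = 0 := by
      rw [← hp]; linear_combination X * hs
    rw [hΔ, pi_eq]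
    linear_combination -8 * Δ * e1 + (32 * f ^ 2 * Δ ^ 2 + 64 * Δ ^ 3) * I2
  obtain ⟨γ, σ, hσ, h5⟩ := N_half hf hfg (od_mul.1 hoxx).1 hoΔ (hq hsum hxx)
  obtain ⟨γ', σ', hσ', h5'⟩ := N_half hf hfg (od_mul.1 hoxx).2 hoΔ
    (hq (by rw [add_comm]; exact hsum) (by rw [mul_comm]; exact hxx))
  have hprod : (x ^ 2 - 8 * Δ ^ 2) * (x' ^ 2 - 8 * Δ ^ 2) = - ka * Δ ^ 2 * f ^ 4 := by
    have e2 : x ^ 2 + x' ^ 2 = (x + x') ^ 2 - 2 * (x * x') := by ring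
    calc (x ^ 2 - 8 * Δ ^ 2) * (x' ^ 2 - 8 * Δ ^ 2)
        = (x * x') ^ 2 - 8 * Δ ^ 2 * (x ^ 2 + x' ^ 2) + 64 * Δ ^ 4 := by ring
      _ = _ := by
        rw [e2, hsum, hxx, ka_eq]
        have hI3 : I ^ 3 = - I := by rfl
        ring_nf
        simp only [I2, I4, hI3]
        ring
  rw [h5, h5'] at hprod
  have hs2 : ka * (γ * γ') ^ 2 = (-(σ * σ')) * Δ ^ 2 := by
    apply mul_left_cancel₀ (mul_ne_zero ka_ne (pow_ne_zero 4 (od_ne hf)))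
    have e1 : (σ * σ') ^ 2 = 1 := by
      rcases hσ with rfl | rfl <;> rcases hσ' with rfl | rfl <;> ring
    linear_combination (σ * σ') * hprod - (ka ^ 2 * γ ^ 2 * γ' ^ 2 * f ^ 4) * e1
  refine ka_not_sq (od_ne hoΔ) ?_ hs2
  rcases hσ with rfl | rfl <;> rcases hσ' with rfl | rfl <;> simp

end N3M3

namespace N3M3

lemma M_B (l : ℕ) {s t e w : Gi} (hs : Od s) (ht : Od t) (hc : IsCoprime s (2 ^ (l + 1) * t))
    (hw : t ^ 2 = s ^ 2 + 4 * w)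
    (h : e ^ 2 = ka * s ^ 4 + 6 * s ^ 2 * (2 ^ (l + 1) * t) ^ 2 + (2 ^ (l + 1) * t) ^ 4) : False := by
  have hP : Od (3 * s ^ 2 + (2 ^ (l + 1) * t) ^ 2) := by
    refine od_add_even (od_mul.2 ⟨od3, od_pow hs⟩) ?_
    exact (pi_dvd_two.mul_right (2 * (2 ^ l * t) ^ 2)).trans (by ring_nf; exact dvd_rfl)
  have hcP : IsCoprime (3 * s ^ 2 + (2 ^ (l + 1) * t) ^ 2) s := by
    rw [show 3 * s ^ 2 + (2 ^ (l + 1) * t) ^ 2 = (2 ^ (l + 1) * t) ^ 2 + s * (3 * s) by ring]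
    exact (hc.symm.pow_left (m := 2)).add_mul_left_left _
  obtain ⟨e1, e2, c, d, z, he, hcd, hoc, hod, hcop, hPe, hz⟩ := ML (e := e) hP hs hcP
    (by rw [h, ka_eq, pi_eq]; ring)
  obtain ⟨y, hy⟩ := sq_form hs
  obtain ⟨y2, hy2⟩ := sq_form ht
  cases l with
  | succ l =>
    clear hPe
    have e3 : 3 * s ^ 2 + (2 ^ (l + 1 + 1) * t) ^ 2 = 3 * s ^ 2 + 8 * (2 * (2 ^ l * t) ^ 2) := by ring
    rw [e3] at hz
    generalize 2 * (2 ^ l * t) ^ 2 = T at *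
    rcases hy with hy | hy <;> rw [hy] at hz <;>
    rcases hz with ⟨-, -, hz⟩ | ⟨-, -, hz⟩ | ⟨-, -, hz⟩ | ⟨-, -, hz⟩ <;>
    have h1 := re_of_eq hz <;> have h2 := im_of_eq hz <;> simp at h1 h2 <;> omega
  | zero =>
    have e3 : 3 * s ^ 2 + (2 ^ (0 + 1) * t) ^ 2 = 3 * s ^ 2 + 4 * t ^ 2 := by ring
    rw [e3] at hz hPe
    have hk : (e1 = I ∧ e2 = -I ∧ s ^ 2 = -1 + 4 * (pi * y)) ∨
        (e1 = -I ∧ e2 = I ∧ s ^ 2 = 1 + 4 * (pi * y)) := by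
      rcases hy with hy | hy <;> rcases hy2 with hy2 | hy2 <;> rw [hy, hy2] at hz <;>
      rcases hz with ⟨h3, h4, hz⟩ | ⟨h3, h4, hz⟩ | ⟨h3, h4, hz⟩ | ⟨h3, h4, hz⟩ <;>
      first
      | (exfalso; have h1 := re_of_eq hz; have h2 := im_of_eq hz; simp at h1 h2; omega)
      | (left; refine ⟨h3, h4, ?_⟩; linear_combination hy; done)
      | (right; refine ⟨h3, h4, ?_⟩; linear_combination hy; done)
    rcases hk with ⟨rfl, rfl, h5⟩ | ⟨rfl, rfl, h5⟩
    · refine N (f := d) (g := I * c) (τ := t) (y := pi * y + w) hod (od_mul.2 ⟨by rfl, hoc⟩) ht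
        (cop_I hcop.symm) (by rw [hw, h5]; ring) ?_
      rw [← hcd, pi_eq] at hPe
      linear_combination hPe - 3 * d ^ 2 * c ^ 2 * I2 - I * c ^ 4 * I4 - d ^ 4 * I2
    · refine N (f := d) (g := c) (τ := I * t) (y := -(pi * y + w)) hod hoc
        (od_mul.2 ⟨by rfl, ht⟩) hcop.symm ?_ ?_
      · rw [mul_pow, I2, hw, h5]; ring
      rw [← hcd, pi_eq] at hPe
      linear_combination 4 * t ^ 2 * I2 - hPe - d ^ 4 * I2

lemma B1 {s t e : Gi} (hs : Od s) (hc : IsCoprime s (2 * t)) (ht : t ≠ 0)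
    (h : e ^ 2 = s ^ 4 + 6 * s ^ 2 * (2 * t) ^ 2 + ka * (2 * t) ^ 4) :
    ∃ η a b, Eta η ∧ a * b = η * t ∧ Od a ∧ IsCoprime a (2 * b) ∧
      (η * s) ^ 2 = a ^ 4 - 3 * a ^ 2 * (2 * b) ^ 2 + pi * (2 * b) ^ 4 := by
  have hP : Od (s ^ 2 + 3 * (2 * t) ^ 2) :=
    od_add_even (od_pow hs) ((pi_dvd_two.mul_right (6 * t ^ 2)).trans (by ring_nf; exact dvd_rfl))
  have hcP : IsCoprime (s ^ 2 + 3 * (2 * t) ^ 2) (2 * t) := by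
    rw [show s ^ 2 + 3 * (2 * t) ^ 2 = s ^ 2 + (3 * (2 * t)) * (2 * t) by ring]
    exact (hc.pow_left (m := 2)).add_mul_right_left _
  obtain ⟨e1, e2, c, d, he, hcd, hoc, hcop, hh⟩ := Spl 4 (by norm_num) (e := e) (K := 1) (r := -pi)
    1 hP (Or.inl rfl) (by simp) (mul_ne_zero two_ne ht) hcP
    (by rw [h, ka_eq, pi_eq]; ring)
    ⟨-(2 * t) ^ 4, by ring⟩
  obtain ⟨b, rfl, hcb⟩ := pow2_dvd 1 (x := t) hoc (by rw [hcd, pow_one])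
  rw [pow_one] at *
  have hPe : s ^ 2 + 3 * (2 * t) ^ 2 = e1 * c ^ 4 + pi * e2 * (2 * b) ^ 4 := by
    rcases hh with hh | hh <;> rw [hh.1] <;> ring
  obtain ⟨w, hw⟩ := sq2 hs
  rcases upm4 (w := w + 6 * t ^ 2 - 8 * pi * e2 * b ^ 4) he hoc
    (by linear_combination hw - hPe) with ⟨rfl, rfl⟩ | ⟨rfl, rfl⟩
  · refine ⟨1, c, b, eta1, by rw [hcb, one_mul], hoc, hcop, ?_⟩
    rw [← hcb] at hPe
    linear_combination hPe
  · refine ⟨I, c, I * b, etaI, by rw [← hcb]; ring, hoc, ?_, ?_⟩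
    · have := cop_I hcop
      rwa [show I * (2 * b) = 2 * (I * b) by ring] at this
    rw [← hcb] at hPe
    linear_combination (s ^ 2 + 12 * c ^ 2 * b ^ 2) * I2 - hPe - 16 * pi * b ^ 4 * I4

lemma B2 {a b0 s1 : Gi} (ha : Od a) (hc : IsCoprime a (2 * b0)) (hb : b0 ≠ 0)
    (h : s1 ^ 2 = a ^ 4 - 3 * a ^ 2 * (2 * (2 * b0)) ^ 2 + pi * (2 * (2 * b0)) ^ 4) :
    ∃ η c d, Eta η ∧ c * d = η * b0 ∧ Od c ∧ IsCoprime c (2 * d) ∧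
      ((η * a) ^ 2 = c ^ 4 + 6 * c ^ 2 * (2 * d) ^ 2 + ka * (2 * d) ^ 4 ∨
       (η * a) ^ 2 = ka * c ^ 4 + 6 * c ^ 2 * (2 * d) ^ 2 + (2 * d) ^ 4) := by
  have hP : Od (a ^ 2 + -6 * (2 * b0) ^ 2) :=
    od_add_even (od_pow ha) ((pi_dvd_two.mul_right (-12 * b0 ^ 2)).trans (by ring_nf; exact dvd_rfl))
  have hcP : IsCoprime (a ^ 2 + -6 * (2 * b0) ^ 2) (2 * b0) := by
    rw [show a ^ 2 + -6 * (2 * b0) ^ 2 = a ^ 2 + (-6 * (2 * b0)) * (2 * b0) by ring]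
    exact (hc.pow_left (m := 2)).add_mul_right_left _
  obtain ⟨e1, e2, c, d, he, hcd, hoc, hcop, hh⟩ := Spl 4 (by norm_num) (e := s1) (K := ka) (r := -1)
    1 hP (Or.inr ka_irred) (by simp) (mul_ne_zero two_ne hb) hcP
    (by rw [h, ka_eq, pi_eq]; ring)
    ((pi_dvd_two.mul_right (- ka * 8 * b0 ^ 4)).trans (by ring_nf; exact dvd_rfl))
  obtain ⟨b, rfl, hcb⟩ := pow2_dvd 1 (x := b0) hoc (by rw [hcd, pow_one])
  rw [pow_one] at *
  have hcb2 : IsCoprime c (2 * (I * b)) := by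
    have := cop_I hcop
    rwa [show I * (2 * b) = 2 * (I * b) by ring] at this
  obtain ⟨w, hw⟩ := sq2 ha
  rcases hh with ⟨hh, -⟩ | ⟨hh, -⟩
  · rcases upm4 (w := w - 12 * b0 ^ 2 - 8 * ka * e2 * b ^ 4) he hoc
      (by linear_combination hw - hh) with ⟨rfl, rfl⟩ | ⟨rfl, rfl⟩
    · refine ⟨1, c, b, eta1, by rw [hcb, one_mul], hoc, hcop, Or.inl ?_⟩
      rw [← hcb] at hh
      linear_combination hh
    · refine ⟨I, c, I * b, etaI, by rw [← hcb]; ring, hoc, hcb2, Or.inl ?_⟩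
      rw [← hcb] at hh
      linear_combination (a ^ 2 - 24 * c ^ 2 * b ^ 2) * I2 - hh - 16 * ka * b ^ 4 * I4
  · have hka : ka = 1 + 4 * (1 - I) := by rfl
    rcases upm4 (w := w - 12 * b0 ^ 2 - 8 * e2 * b ^ 4 - 2 * (1 - I) * e1 * c ^ 4) he hoc
      (by rw [hka] at hh; linear_combination hw - hh) with ⟨rfl, rfl⟩ | ⟨rfl, rfl⟩
    · refine ⟨1, c, b, eta1, by rw [hcb, one_mul], hoc, hcop, Or.inr ?_⟩
      rw [← hcb] at hh
      linear_combination hh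
    · refine ⟨I, c, I * b, etaI, by rw [← hcb]; ring, hoc, hcb2, Or.inr ?_⟩
      rw [← hcb] at hh
      linear_combination (a ^ 2 - 24 * c ^ 2 * b ^ 2) * I2 - hh - 16 * b ^ 4 * I4

lemma LB : ∀ (j : ℕ) {s t e z : Gi}, Od s → Od t → IsCoprime s (2 ^ (j + 1) * t) →
    t ^ 2 = s ^ 2 + 4 * z →
    e ^ 2 = s ^ 4 + 6 * s ^ 2 * (2 ^ (j + 1) * t) ^ 2 + ka * (2 ^ (j + 1) * t) ^ 4 → False := by
  intro j
  induction j with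
  | zero =>
    intro s t e z hs ht hc hz h
    rw [show (0 + 1 : ℕ) = 1 by rfl, pow_one] at *
    obtain ⟨η1, a, b, hη1, hab, ha, hcop, h1⟩ := B1 hs hc (od_ne ht) h
    have hb' : Od b := (od_mul.1 (hab ▸ od_mul.2 ⟨eta_od hη1, ht⟩)).2
    have ho1 : Od (η1 * s) := od_mul.2 ⟨eta_od hη1, hs⟩
    have hP : Od (a ^ 2 + -6 * b ^ 2) :=
      od_add_even (od_pow ha) ((pi_dvd_two.mul_right (-3 * b ^ 2)).trans (by ring_nf; exact dvd_rfl))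
    obtain ⟨y1, hy1⟩ := sq_form ho1
    obtain ⟨y2, hy2⟩ := sq_form hP
    obtain ⟨y3, hy3⟩ := four_form hb'
    have h2 : (η1 * s) ^ 2 = (a ^ 2 + -6 * b ^ 2) ^ 2 - 4 * ka * b ^ 4 := by
      rw [h1, ka_eq, pi_eq]; ring
    rw [hy3] at h2
    have h3 : (η1 * s) ^ 2 = (a ^ 2 + -6 * b ^ 2) ^ 2 - 4 * ka - 8 * (4 * ka * pi * y3) := by
      rw [h2]; ring
    generalize 4 * ka * pi * y3 = W at *
    clear h2 h1
    rcases hy1 with hy1 | hy1 <;> rcases hy2 with hy2 | hy2 <;> rw [hy1, hy2] at h3 <;>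
    have h1 := re_of_eq h3 <;> have h2 := im_of_eq h3 <;> simp at h1 h2 <;> omega
  | succ j ih =>
    intro s t e z hs ht hc hz h
    rw [show (2 : Gi) ^ (j + 1 + 1) * t = 2 * (2 ^ (j + 1) * t) by ring] at hc h
    obtain ⟨η1, a, b, hη1, hab, ha, hcop, h1⟩ := B1 hs hc
      (mul_ne_zero (pow_ne_zero _ two_ne) (od_ne ht)) h
    obtain ⟨b', rfl, hab'⟩ := pow2_dvd (j + 1) (x := η1 * t) ha (by rw [hab]; ring)
    have hb' : Od b' := (od_mul.1 (hab' ▸ od_mul.2 ⟨eta_od hη1, ht⟩)).2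
    rw [show (2 : Gi) ^ (j + 1) * b' = 2 * (2 ^ j * b') by ring] at h1 hcop
    obtain ⟨η2, c, d, hη2, hcd, hoc, hcop2, h2⟩ := B2 ha (cop_of_cop_mul hcop)
      (mul_ne_zero (pow_ne_zero _ two_ne) (od_ne hb')) h1
    obtain ⟨d', rfl, hcd'⟩ := pow2_dvd j (x := η2 * b') hoc (by rw [hcd]; ring)
    have hd : Od d' := (od_mul.1 (hcd' ▸ od_mul.2 ⟨eta_od hη2, hb'⟩)).2
    obtain ⟨y1, hy1⟩ := four_form ha
    obtain ⟨y2, hy2⟩ := four_form hoc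
    have hdir := fun x3 h3 => direct (x1 := 2 * pi * y1 - 12 * a ^ 2 * (2 ^ j * b') ^ 2
          + 64 * pi * (2 ^ j * b') ^ 4) (x2 := z) (x3 := x3) hη2 hoc hab' hcd'
        (by rw [h1, hy1]; ring) hz h3
    rw [show 2 * ((2 : Gi) ^ j * d') = 2 ^ (j + 1) * d' by ring] at h2 hcop2
    rcases h2 with h2 | h2
    · obtain ⟨z', hz'⟩ := hdir (2 * pi * y2 + 6 * c ^ 2 * (2 ^ j * d') ^ 2
          + 4 * ka * (2 ^ j * d') ^ 4) (by rw [h2, hy2]; ring)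
      exact ih hoc hd hcop2 hz' h2
    · obtain ⟨z', hz'⟩ := hdir (ka * 2 * pi * y2 + 6 * c ^ 2 * (2 ^ j * d') ^ 2
          + 4 * (2 ^ j * d') ^ 4 + (1 - I)) (by rw [h2, hy2, ka_eq]; ring)
      exact M_B j hoc hd hcop2 hz' h2

end N3M3

namespace N3M3

lemma red_od {s t : Gi} (hs : Od s) (ht : t ≠ 0) : ∃ γ s' t', s = γ * s' ∧ t = γ * t' ∧
    IsCoprime s' t' ∧ Od γ ∧ Od s' ∧ γ ≠ 0 := by
  obtain ⟨γ, s', t', h1, h2, h3, h4⟩ := red s t (od_ne hs)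
  have h5 := od_mul.1 (h1 ▸ hs)
  exact ⟨γ, s', t', h1, h2, h3, h5.1, h5.2, h4⟩

lemma cop_two_pow {s t : Gi} (n : ℕ) (hs : Od s) (h : IsCoprime s t) : IsCoprime s (2 ^ n * t) :=
  ((od_coprime_two hs).pow_right (n := n)).mul_right h

lemma dir_div {γ s t z : Gi} (hγ : Od γ) (h : (γ * t) ^ 2 = (γ * s) ^ 2 + 4 * z) :
    ∃ z', t ^ 2 = s ^ 2 + 4 * z' := by
  obtain ⟨b', hb, -⟩ := pow2_dvd (a := γ ^ 2) (b := t ^ 2 - s ^ 2) (x := z) 2 (od_pow hγ)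
    (by linear_combination h)
  exact ⟨b', by linear_combination hb⟩

lemma LA' (j : ℕ) {s t e z : Gi} (hs : Od s) (ht : Od t) (hz : t ^ 2 = s ^ 2 + 4 * z)
    (h : e ^ 2 = s ^ 4 + 12 * s ^ 2 * (2 ^ (j + 1) * t) ^ 2 + 4 * ka * (2 ^ (j + 1) * t) ^ 4) :
    False := by
  obtain ⟨γ, s', t', rfl, rfl, hc, hγ, hs', h0⟩ := red_od hs (od_ne ht)
  obtain ⟨z', hz'⟩ := dir_div hγ hz
  obtain ⟨e', he'⟩ := sq_div (e := e) h0 (X := s' ^ 4 + 12 * s' ^ 2 * (2 ^ (j + 1) * t') ^ 2 +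
    4 * ka * (2 ^ (j + 1) * t') ^ 4) (by rw [h]; ring)
  exact LA j hs' (od_mul.1 ht).2 (cop_two_pow _ hs' hc) hz' he'

lemma LB' (j : ℕ) {s t e z : Gi} (hs : Od s) (ht : Od t) (hz : t ^ 2 = s ^ 2 + 4 * z)
    (h : e ^ 2 = s ^ 4 + 6 * s ^ 2 * (2 ^ (j + 1) * t) ^ 2 + ka * (2 ^ (j + 1) * t) ^ 4) :
    False := by
  obtain ⟨γ, s', t', rfl, rfl, hc, hγ, hs', h0⟩ := red_od hs (od_ne ht)
  obtain ⟨z', hz'⟩ := dir_div hγ hz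
  obtain ⟨e', he'⟩ := sq_div (e := e) h0 (X := s' ^ 4 + 6 * s' ^ 2 * (2 ^ (j + 1) * t') ^ 2 +
    ka * (2 ^ (j + 1) * t') ^ 4) (by rw [h]; ring)
  exact LB j hs' (od_mul.1 ht).2 (cop_two_pow _ hs' hc) hz' he'

lemma M_B' (j : ℕ) {s t e z : Gi} (hs : Od s) (ht : Od t) (hz : t ^ 2 = s ^ 2 + 4 * z)
    (h : e ^ 2 = ka * s ^ 4 + 6 * s ^ 2 * (2 ^ (j + 1) * t) ^ 2 + (2 ^ (j + 1) * t) ^ 4) :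
    False := by
  obtain ⟨γ, s', t', rfl, rfl, hc, hγ, hs', h0⟩ := red_od hs (od_ne ht)
  obtain ⟨z', hz'⟩ := dir_div hγ hz
  obtain ⟨e', he'⟩ := sq_div (e := e) h0 (X := ka * s' ^ 4 + 6 * s' ^ 2 * (2 ^ (j + 1) * t') ^ 2 +
    (2 ^ (j + 1) * t') ^ 4) (by rw [h]; ring)
  exact M_B j hs' (od_mul.1 ht).2 (cop_two_pow _ hs' hc) hz' he'

lemma M_A' {s t e : Gi} (hs : Od s) (ht : t ≠ 0)
    (h : e ^ 2 = ka * s ^ 4 + 12 * s ^ 2 * (2 * t) ^ 2 + 4 * (2 * t) ^ 4) : False := by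
  obtain ⟨γ, s', t', rfl, rfl, hc, hγ, hs', h0⟩ := red_od hs ht
  obtain ⟨e', he'⟩ := sq_div (e := e) h0 (X := ka * s' ^ 4 + 12 * s' ^ 2 * (2 * t') ^ 2 +
    4 * (2 * t') ^ 4) (by rw [h]; ring)
  have := cop_two_pow 1 hs' hc
  rw [pow_one] at this
  exact M_A hs' this (Or.inl ⟨t', rfl⟩) he'

lemma LC' (l : ℕ) {s t e : Gi} (hs : Od s) (ht : Od t)
    (h : e ^ 2 = s ^ 4 + 6 * (I - 1) * s ^ 2 * (pi * (2 ^ l * t)) ^ 2 +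
      (I - 1) ^ 2 * ka * (pi * (2 ^ l * t)) ^ 4) : False := by
  obtain ⟨γ, s', t', rfl, rfl, hc, hγ, hs', h0⟩ := red_od hs (od_ne ht)
  obtain ⟨e', he'⟩ := sq_div (e := e) h0 (X := s' ^ 4 + 6 * (I - 1) * s' ^ 2 *
    (pi * (2 ^ l * t')) ^ 2 + (I - 1) ^ 2 * ka * (pi * (2 ^ l * t')) ^ 4) (by rw [h]; ring)
  exact LC l hs' (od_mul.1 ht).2 ((od_coprime_pi hs').mul_right (cop_two_pow _ hs' hc)) he'

lemma M_C' {s t e : Gi} (hs : Od s) (ht : t ≠ 0)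
    (h : e ^ 2 = ka * s ^ 4 + 6 * (I - 1) * s ^ 2 * (pi * t) ^ 2 +
      (I - 1) ^ 2 * (pi * t) ^ 4) : False := by
  obtain ⟨γ, s', t', rfl, rfl, hc, hγ, hs', h0⟩ := red_od hs ht
  obtain ⟨e', he'⟩ := sq_div (e := e) h0 (X := ka * s' ^ 4 + 6 * (I - 1) * s' ^ 2 *
    (pi * t') ^ 2 + (I - 1) ^ 2 * (pi * t') ^ 4) (by rw [h]; ring)
  exact M_C hs' ((od_coprime_pi hs').mul_right hc) he'

lemma I_sq2 (x : Gi) : (I * x) ^ 2 = - x ^ 2 := by rw [mul_pow, I2]; ring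

/-- quadratic splitting with the unit absorbed -/
lemma Spl2 {P e b w : Gi} (hP : P = 1 + 2 * w) (hb : b ≠ 0) (hpb : pi ∣ b) (hc : IsCoprime P b)
    (h : e ^ 2 = P ^ 2 + 4 * (ka * b ^ 2)) :
    ∃ f g, f * g = b ∧ Od f ∧ (P = f ^ 2 - ka * g ^ 2 ∨ P = ka * f ^ 2 - g ^ 2) := by
  have hoP : Od P := by
    rw [hP]; exact od_add_even (by rfl) (pi_dvd_two.mul_right _)
  obtain ⟨e1, e2, c, d, he, hcd, hoc, hcop, hh⟩ := Spl 2 (by norm_num) (e := e) (K := ka) (r := 1)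
    1 hoP (Or.inr ka_irred) (by simp) hb hc (by rw [h]; ring)
    ((hpb.mul_left (ka * b)).trans (by ring_nf; exact dvd_rfl))
  obtain ⟨b', rfl⟩ := hpb
  obtain ⟨d', rfl, -⟩ := pi_dvd_of hoc hcd
  have hd2 : (pi * d') ^ 2 = 2 * (I * d' ^ 2) := by rw [mul_pow, pp]; ring
  have hf : (I * c) * (-I * (pi * d')) = c * (pi * d') := by linear_combination -c * (pi * d') * I2
  rcases hh with ⟨hh, -⟩ | ⟨hh, -⟩
  · rcases upm (w := w + ka * e2 * I * d' ^ 2) he hoc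
      (by rw [hd2] at hh; linear_combination hP - hh) with ⟨rfl, rfl⟩ | ⟨rfl, rfl⟩
    · exact ⟨c, pi * d', hcd, hoc, Or.inl (by rw [hh]; ring)⟩
    · refine ⟨I * c, -I * (pi * d'), by rw [hf, hcd], od_mul.2 ⟨by rfl, hoc⟩, Or.inl ?_⟩
      rw [hh, show (-I * (pi * d')) ^ 2 = (I * (pi * d')) ^ 2 by ring, I_sq2, I_sq2]; ring
  · have hka : ka = 1 + 4 * (1 - I) := by rfl
    rcases upm (w := w + e2 * I * d' ^ 2 - 2 * (1 - I) * e1 * c ^ 2) he hoc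
      (by rw [hd2, hka] at hh; linear_combination hP - hh) with ⟨rfl, rfl⟩ | ⟨rfl, rfl⟩
    · exact ⟨c, pi * d', hcd, hoc, Or.inr (by rw [hh]; ring)⟩
    · refine ⟨I * c, -I * (pi * d'), by rw [hf, hcd], od_mul.2 ⟨by rfl, hoc⟩, Or.inr ?_⟩
      rw [hh, show (-I * (pi * d')) ^ 2 = (I * (pi * d')) ^ 2 by ring, I_sq2, I_sq2]; ring

lemma topA {m o c x y : Gi} (j : ℕ) (hm : Od m) (ho : Od o) (hc : IsCoprime m o)
    (hx : m ^ 2 = 1 + 4 * x) (hy : o ^ 2 = 1 + 4 * y)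
    (h : c ^ 2 = (m ^ 2 - 4 * (2 ^ (j + 1) * o) ^ 2 + 2 * (2 + I) * m * (2 ^ (j + 1) * o)) ^ 2
      + 4 * (ka * (m * (2 ^ (j + 1) * o)) ^ 2)) : False := by
  have hT : (2 : Gi) ^ (j + 1) * o = 2 * (2 ^ j * o) := by ring
  have hcT := cop_two_pow (j + 1) hm hc
  have hT0 : (2 : Gi) ^ j * o ≠ 0 := mul_ne_zero (pow_ne_zero _ two_ne) (od_ne ho)
  have hfo : ∀ f g : Gi, f * g = m * (2 ^ (j + 1) * o) → Od f → ∃ g', g = 2 ^ (j + 1) * g' := by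
    intro f g hfg hof
    obtain ⟨g', hg', -⟩ := pow2_dvd (j + 1) (x := m * o) hof (by rw [hfg]; ring)
    exact ⟨g', hg'⟩
  have hX : m ^ 2 - 4 * (2 ^ (j + 1) * o) ^ 2 + 2 * (2 + I) * m * (2 ^ (j + 1) * o) =
      1 + 4 * (x - (2 ^ (j + 1) * o) ^ 2 + (2 + I) * m * (2 ^ j * o)) := by
    rw [hx]; ring
  have hcP : IsCoprime (m ^ 2 - 4 * (2 ^ (j + 1) * o) ^ 2 + 2 * (2 + I) * m * (2 ^ (j + 1) * o))
      (m * (2 ^ (j + 1) * o)) := by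
    refine IsCoprime.mul_right ?_ ?_
    · rw [show m ^ 2 - 4 * (2 ^ (j + 1) * o) ^ 2 + 2 * (2 + I) * m * (2 ^ (j + 1) * o) =
        -(4 * (2 ^ (j + 1) * o) ^ 2) + m * (m + 2 * (2 + I) * (2 ^ (j + 1) * o)) by ring]
      refine IsCoprime.add_mul_left_left ?_ _
      refine IsCoprime.neg_left ?_
      rw [show (4 : Gi) = 2 ^ 2 by rfl]
      exact (cop_two_pow 2 hm hcT.pow_right).symm
    · rw [show m ^ 2 - 4 * (2 ^ (j + 1) * o) ^ 2 + 2 * (2 + I) * m * (2 ^ (j + 1) * o) =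
        m ^ 2 + (2 ^ (j + 1) * o) * (2 * (2 + I) * m - 4 * (2 ^ (j + 1) * o)) by ring]
      exact hcT.pow_left.add_mul_left_left _
  obtain ⟨f, g, hfg, hof, hh⟩ := Spl2 (w := 2 * (x - (2 ^ (j + 1) * o) ^ 2 + (2 + I) * m * (2 ^ j * o)))
    (by rw [hX]; ring) (mul_ne_zero (od_ne hm) (by rw [hT]; exact mul_ne_zero two_ne hT0))
    (by rw [hT, ← mul_assoc, mul_comm m 2, mul_assoc]; exact pi_dvd_two.mul_right _) hcP h
  obtain ⟨g', hg'⟩ := hfo f g hfg hof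
  rcases hh with hh | hh
  · have hk : (f * m + ka * (2 ^ (j + 1) * o) * g + (2 + I) * f * (2 ^ (j + 1) * o)) ^ 2 =
      f ^ 4 + 12 * f ^ 2 * (2 ^ (j + 1) * o) ^ 2 + 4 * ka * (2 ^ (j + 1) * o) ^ 4 := by
      clear hX hcP hfo hT hcT h
      generalize 2 ^ (j + 1) * o = t at *
      linear_combination (f ^ 2 + ka * t ^ 2) * hh + (2 * ka * m * t + 2 * (2 + I) * ka * t ^ 2
        - ka * (f * g + m * t)) * hfg + f ^ 2 * t ^ 2 * (ka_eq + I2)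
    refine LA' j (z := y - (x - (2 ^ (j + 1) * o) ^ 2 + (2 + I) * m * (2 ^ j * o)) -
      ka * (2 ^ j * g') ^ 2) hof ho ?_ hk
    rw [hX, hg'] at hh
    linear_combination hy + hh
  · have hk : (f * m + (2 ^ (j + 1) * o) * g + (2 + I) * f * (2 ^ (j + 1) * o)) ^ 2 =
      ka * f ^ 4 + 12 * f ^ 2 * (2 ^ (j + 1) * o) ^ 2 + 4 * (2 ^ (j + 1) * o) ^ 4 := by
      clear hX hcP hfo hT hcT h
      generalize 2 ^ (j + 1) * o = t at *
      linear_combination (f ^ 2 + t ^ 2) * hh + (2 * m * t + 2 * (2 + I) * t ^ 2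
        - (f * g + m * t)) * hfg + f ^ 2 * t ^ 2 * (ka_eq + I2)
    rw [hT] at hk
    exact M_A' hof hT0 hk

lemma topB {m o c x y : Gi} (j : ℕ) (hm : Od m) (ho : Od o) (hc : IsCoprime m o)
    (hx : m ^ 2 = 1 + 4 * x) (hy : o ^ 2 = 1 + 4 * y)
    (h : c ^ 2 = (m ^ 2 - 16 * (2 ^ (j + 1) * o) ^ 2 - 2 * (2 + I) * m * (2 ^ (j + 1) * o)) ^ 2
      + 4 * (ka * (m * (2 ^ (j + 1) * o)) ^ 2)) : False := by
  have hT : (2 : Gi) ^ (j + 1) * o = 2 * (2 ^ j * o) := by ring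
  have hcT := cop_two_pow (j + 1) hm hc
  have hT0 : (2 : Gi) ^ j * o ≠ 0 := mul_ne_zero (pow_ne_zero _ two_ne) (od_ne ho)
  have hfo : ∀ f g : Gi, f * g = m * (2 ^ (j + 1) * o) → Od f → ∃ g', g = 2 ^ (j + 1) * g' := by
    intro f g hfg hof
    obtain ⟨g', hg', -⟩ := pow2_dvd (j + 1) (x := m * o) hof (by rw [hfg]; ring)
    exact ⟨g', hg'⟩
  have hX : m ^ 2 - 16 * (2 ^ (j + 1) * o) ^ 2 - 2 * (2 + I) * m * (2 ^ (j + 1) * o) =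
      1 + 4 * (x - 4 * (2 ^ (j + 1) * o) ^ 2 - (2 + I) * m * (2 ^ j * o)) := by
    rw [hx]; ring
  have hcP : IsCoprime (m ^ 2 - 16 * (2 ^ (j + 1) * o) ^ 2 - 2 * (2 + I) * m * (2 ^ (j + 1) * o))
      (m * (2 ^ (j + 1) * o)) := by
    refine IsCoprime.mul_right ?_ ?_
    · rw [show m ^ 2 - 16 * (2 ^ (j + 1) * o) ^ 2 - 2 * (2 + I) * m * (2 ^ (j + 1) * o) =
        -(16 * (2 ^ (j + 1) * o) ^ 2) + m * (m - 2 * (2 + I) * (2 ^ (j + 1) * o)) by ring]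
      refine IsCoprime.add_mul_left_left ?_ _
      refine IsCoprime.neg_left ?_
      rw [show (16 : Gi) = 2 ^ 4 by rfl]
      exact (cop_two_pow 4 hm hcT.pow_right).symm
    · rw [show m ^ 2 - 16 * (2 ^ (j + 1) * o) ^ 2 - 2 * (2 + I) * m * (2 ^ (j + 1) * o) =
        m ^ 2 + (2 ^ (j + 1) * o) * (-2 * (2 + I) * m - 16 * (2 ^ (j + 1) * o)) by ring]
      exact hcT.pow_left.add_mul_left_left _
  obtain ⟨f, g, hfg, hof, hh⟩ := Spl2 (w := 2 * (x - 4 * (2 ^ (j + 1) * o) ^ 2 - (2 + I) * m * (2 ^ j * o)))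
    (by rw [hX]; ring) (mul_ne_zero (od_ne hm) (by rw [hT]; exact mul_ne_zero two_ne hT0))
    (by rw [hT, ← mul_assoc, mul_comm m 2, mul_assoc]; exact pi_dvd_two.mul_right _) hcP h
  obtain ⟨g', hg'⟩ := hfo f g hfg hof
  have e2 : (2 : Gi) ^ (j + 1 + 1) * o = 2 * (2 ^ (j + 1) * o) := by ring
  rcases hh with hh | hh
  · have hk : (f * m + ka * (2 ^ (j + 1) * o) * g - (2 + I) * f * (2 ^ (j + 1) * o)) ^ 2 =
      f ^ 4 + 6 * f ^ 2 * (2 ^ (j + 1 + 1) * o) ^ 2 + ka * (2 ^ (j + 1 + 1) * o) ^ 4 := by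
      rw [e2]
      clear hX hcP hfo hT hcT h e2
      generalize 2 ^ (j + 1) * o = t at *
      linear_combination (f ^ 2 + ka * t ^ 2) * hh + (2 * ka * m * t - 2 * (2 + I) * ka * t ^ 2
        - ka * (f * g + m * t)) * hfg + f ^ 2 * t ^ 2 * (ka_eq + I2)
    refine LB' (j + 1) (z := y - (x - 4 * (2 ^ (j + 1) * o) ^ 2 - (2 + I) * m * (2 ^ j * o)) -
      ka * (2 ^ j * g') ^ 2) hof ho ?_ hk
    rw [hX, hg'] at hh
    linear_combination hy + hh
  · have hk : (f * m + (2 ^ (j + 1) * o) * g - (2 + I) * f * (2 ^ (j + 1) * o)) ^ 2 =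
      ka * f ^ 4 + 6 * f ^ 2 * (2 ^ (j + 1 + 1) * o) ^ 2 + (2 ^ (j + 1 + 1) * o) ^ 4 := by
      rw [e2]
      clear hX hcP hfo hT hcT h e2
      generalize 2 ^ (j + 1) * o = t at *
      linear_combination (f ^ 2 + t ^ 2) * hh + (2 * m * t - 2 * (2 + I) * t ^ 2
        - (f * g + m * t)) * hfg + f ^ 2 * t ^ 2 * (ka_eq + I2)
    refine M_B' (j + 1) (z := y - (x - 4 * (2 ^ (j + 1) * o) ^ 2 - (2 + I) * m * (2 ^ j * o)) -
      (2 ^ j * g') ^ 2 + (1 - I) * f ^ 2) hof ho ?_ hk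
    rw [hX, hg'] at hh
    linear_combination hy + hh + f ^ 2 * ka_eq

lemma topC {m o c x : Gi} (j : ℕ) (hm : Od m) (ho : Od o) (hc : IsCoprime m o)
    (hx : m ^ 2 = 1 + 2 * x)
    (h : c ^ 2 = (m ^ 2 - 4 * (2 ^ j * o) ^ 2 + 2 * pi * m * (2 ^ j * o)) ^ 2
      + 4 * (ka * (pi * (m * (2 ^ j * o))) ^ 2)) : False := by
  have hcT := cop_two_pow j hm hc
  have hT0 : (2 : Gi) ^ j * o ≠ 0 := mul_ne_zero (pow_ne_zero _ two_ne) (od_ne ho)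
  have hX : m ^ 2 - 4 * (2 ^ j * o) ^ 2 + 2 * pi * m * (2 ^ j * o) =
      1 + 2 * (x - 2 * (2 ^ j * o) ^ 2 + pi * m * (2 ^ j * o)) := by
    rw [hx]; ring
  have hcP : IsCoprime (m ^ 2 - 4 * (2 ^ j * o) ^ 2 + 2 * pi * m * (2 ^ j * o))
      (pi * (m * (2 ^ j * o))) := by
    refine IsCoprime.mul_right ?_ (IsCoprime.mul_right ?_ ?_)
    · apply od_coprime_pi
      rw [hX]; exact od_add_even (by rfl) (pi_dvd_two.mul_right _)
    · rw [show m ^ 2 - 4 * (2 ^ j * o) ^ 2 + 2 * pi * m * (2 ^ j * o) =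
        -(4 * (2 ^ j * o) ^ 2) + m * (m + 2 * pi * (2 ^ j * o)) by ring]
      refine IsCoprime.add_mul_left_left ?_ _
      refine IsCoprime.neg_left ?_
      rw [show (4 : Gi) = 2 ^ 2 by rfl]
      exact (cop_two_pow 2 hm hcT.pow_right).symm
    · rw [show m ^ 2 - 4 * (2 ^ j * o) ^ 2 + 2 * pi * m * (2 ^ j * o) =
        m ^ 2 + (2 ^ j * o) * (2 * pi * m - 4 * (2 ^ j * o)) by ring]
      exact hcT.pow_left.add_mul_left_left _
  obtain ⟨f, g, hfg, hof, hh⟩ := Spl2 hX (mul_ne_zero pi_ne (mul_ne_zero (od_ne hm) hT0))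
    (dvd_mul_right _ _) hcP h
  have e4 : (pi * (2 ^ j * (I * o))) ^ 2 = - (2 * I) * (2 ^ j * o) ^ 2 := by
    rw [← pp]; linear_combination pi ^ 2 * (2 ^ j * o) ^ 2 * I2
  have e5 : (pi * (2 ^ j * (I * o))) ^ 4 = -4 * (2 ^ j * o) ^ 4 := by
    rw [show (pi * (2 ^ j * (I * o))) ^ 4 = ((pi * (2 ^ j * (I * o))) ^ 2) ^ 2 by ring, e4]
    linear_combination 4 * (2 ^ j * o) ^ 4 * I2
  rcases hh with hh | hh
  · refine LC' j (t := I * o) (e := f * m + pi * ka * (2 ^ j * o) * g + pi * f * (2 ^ j * o)) hof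
      (od_mul.2 ⟨by rfl, ho⟩) ?_
    rw [e4, e5]
    clear hX hcP hcT h e4 e5
    generalize 2 ^ j * o = t at *
    linear_combination (f ^ 2 + ka * pi ^ 2 * t ^ 2) * hh + (2 * pi * ka * m * t + 2 * pi ^ 2 * ka * t ^ 2
        - ka * (f * g + pi * m * t)) * hfg + f ^ 2 * t ^ 2 * (2 * I * ka_eq) +
        (f ^ 2 * t ^ 2 * (1 + ka) + 4 * ka * t ^ 4) * pp + (4 * f ^ 2 * t ^ 2 + 4 * ka * t ^ 4) * I2
  · refine M_C' (t := 2 ^ j * (I * o)) (e := f * m + pi * (2 ^ j * o) * g + pi * f * (2 ^ j * o)) hof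
      (mul_ne_zero (pow_ne_zero _ two_ne) (od_ne (od_mul.2 ⟨by rfl, ho⟩))) ?_
    rw [e4, e5]
    clear hX hcP hcT h e4 e5
    generalize 2 ^ j * o = t at *
    linear_combination (f ^ 2 + pi ^ 2 * t ^ 2) * hh + (2 * pi * m * t + 2 * pi ^ 2 * t ^ 2
        - (f * g + pi * m * t)) * hfg + f ^ 2 * t ^ 2 * (2 * I * ka_eq) +
        (f ^ 2 * t ^ 2 * (1 + ka) + 4 * t ^ 4) * pp + (4 * f ^ 2 * t ^ 2 + 4 * t ^ 4) * I2

end N3M3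

namespace N3M3

lemma od_cast {o : ℤ} (h : o % 2 = 1) : Od (o : Gi) := by
  unfold Od; simpa using h

lemma cop_cast {m n : ℤ} (h : IsCoprime m n) : IsCoprime (m : Gi) (n : Gi) := by
  obtain ⟨a, b, h⟩ := h
  exact ⟨a, b, by exact_mod_cast h⟩

lemma odd_sq {o : ℤ} (h : o % 2 = 1) : ∃ x : ℤ, o ^ 2 = 1 + 8 * x := by
  obtain ⟨k, hk⟩ : ∃ k, o = 2 * k + 1 := ⟨o / 2, by omega⟩
  obtain ⟨l, hl⟩ := Int.even_mul_succ_self k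
  exact ⟨l, by rw [hk]; linear_combination 4 * hl⟩

lemma two_adic {n : ℤ} (h : n ≠ 0) : ∃ (k : ℕ) (o : ℤ), n = 2 ^ k * o ∧ o % 2 = 1 := by
  have hf : FiniteMultiplicity (2 : ℤ) n := by
    rw [Int.finiteMultiplicity_iff]; exact ⟨by decide, h⟩
  obtain ⟨o, h1, h2⟩ := hf.exists_eq_pow_mul_and_not_dvd
  exact ⟨_, o, h1, by omega⟩

lemma topA_int {m n : ℤ} {c : Gi} (hm : m % 2 = 1) (hn : 4 ∣ n) (h0 : n ≠ 0) (hc : IsCoprime m n)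
    (h : c ^ 2 = ((m : Gi) ^ 2 - n ^ 2) ^ 2 + (4 + 2 * I) * ((m : Gi) ^ 2 - n ^ 2) * (m * n)
      + 8 * (m * n) ^ 2) : False := by
  obtain ⟨r, rfl⟩ := hn
  obtain ⟨k, o, rfl, ho⟩ := two_adic (n := r) (by rintro rfl; simp at h0)
  obtain ⟨x, hx⟩ := odd_sq hm
  obtain ⟨y, hy⟩ := odd_sq ho
  refine topA (m := m) (o := o) (x := 2 * x) (y := 2 * y) (c := c) k (od_cast hm) (od_cast ho)
    (cop_cast hc.of_mul_right_right.of_mul_right_right) ?_ ?_ ?_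
  · have : ((m ^ 2 : ℤ) : Gi) = ((1 + 8 * x : ℤ) : Gi) := by rw [hx]
    push_cast at this; rw [this]; ring
  · have : ((o ^ 2 : ℤ) : Gi) = ((1 + 8 * y : ℤ) : Gi) := by rw [hy]
    push_cast at this; rw [this]; ring
  · rw [h]; push_cast
    rw [show (4 : Gi) * (2 ^ k * o) = 2 * (2 ^ (k + 1) * o) by ring]
    generalize (2 : Gi) ^ (k + 1) * o = t
    linear_combination (-4 * m ^ 2 * t ^ 2) * ka_eq - 4 * m ^ 2 * t ^ 2 * I2

lemma topB_int {m n : ℤ} {c : Gi} (hm : m % 2 = 1) (hn : 8 ∣ n) (h0 : n ≠ 0) (hc : IsCoprime m n)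
    (h : c ^ 2 = ((m : Gi) ^ 2 - n ^ 2) ^ 2 - (2 + I) * ((m : Gi) ^ 2 - n ^ 2) * (m * n)
      + 2 * (m * n) ^ 2) : False := by
  obtain ⟨r, rfl⟩ := hn
  obtain ⟨k, o, rfl, ho⟩ := two_adic (n := r) (by rintro rfl; simp at h0)
  obtain ⟨x, hx⟩ := odd_sq hm
  obtain ⟨y, hy⟩ := odd_sq ho
  refine topB (m := m) (o := o) (x := 2 * x) (y := 2 * y) (c := c) k (od_cast hm) (od_cast ho)
    (cop_cast hc.of_mul_right_right.of_mul_right_right) ?_ ?_ ?_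
  · have : ((m ^ 2 : ℤ) : Gi) = ((1 + 8 * x : ℤ) : Gi) := by rw [hx]
    push_cast at this; rw [this]; ring
  · have : ((o ^ 2 : ℤ) : Gi) = ((1 + 8 * y : ℤ) : Gi) := by rw [hy]
    push_cast at this; rw [this]; ring
  · rw [h]; push_cast
    rw [show (8 : Gi) * (2 ^ k * o) = 4 * (2 ^ (k + 1) * o) by ring]
    generalize (2 : Gi) ^ (k + 1) * o = t
    linear_combination (-4 * m ^ 2 * t ^ 2) * ka_eq - 4 * m ^ 2 * t ^ 2 * I2

lemma topC_int {m n : ℤ} {c : Gi} (hm : m % 2 = 1) (hn : 2 ∣ n) (h0 : n ≠ 0) (hc : IsCoprime m n)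
    (h : c ^ 2 = ((m : Gi) ^ 2 - n ^ 2) ^ 2 + (2 + 2 * I) * ((m : Gi) ^ 2 - n ^ 2) * (m * n)
      + (8 + 12 * I) * (m * n) ^ 2) : False := by
  obtain ⟨r, rfl⟩ := hn
  obtain ⟨k, o, rfl, ho⟩ := two_adic (n := r) (by rintro rfl; simp at h0)
  obtain ⟨x, hx⟩ := odd_sq hm
  refine topC (m := m) (o := o) (x := 4 * x) (c := c) k (od_cast hm) (od_cast ho)
    (cop_cast hc.of_mul_right_right.of_mul_right_right) ?_ ?_
  · have : ((m ^ 2 : ℤ) : Gi) = ((1 + 8 * x : ℤ) : Gi) := by rw [hx]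
    push_cast at this; rw [this]; ring
  · rw [h]; push_cast
    generalize (2 : Gi) ^ k * o = t
    rw [mul_pow pi, pp, ka_eq, pi_eq]
    linear_combination 28 * m ^ 2 * t ^ 2 * I2

/-- extraction of squares -/
lemma Fac {n0 p q y : ℤ} (h : n0 * (p ^ 2 + q ^ 2) = y ^ 2) (h0 : p ^ 2 + q ^ 2 ≠ 0)
    (hc : IsCoprime ((p : Gi) + q * I) (n0 * ((p : Gi) - q * I))) :
    ∃ (c : Gi) (k : ℤ), n0 = k ^ 2 ∧ ((p : Gi) + q * I = c ^ 2 ∨ (p : Gi) + q * I = I * c ^ 2) := by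
  have h1 : ((p : Gi) + q * I) * (n0 * ((p : Gi) - q * I)) = (y : Gi) ^ 2 := by
    have : ((n0 * (p ^ 2 + q ^ 2) : ℤ) : Gi) = ((y ^ 2 : ℤ) : Gi) := by rw [h]
    push_cast at this
    linear_combination this - (n0 : Gi) * q ^ 2 * I2
  obtain ⟨c, u, hu⟩ := exists_associated_pow_of_mul_eq_pow' hc h1
  have hn : p ^ 2 + q ^ 2 = (c.re ^ 2 + c.im ^ 2) ^ 2 := by
    have hN := congrArg Zsqrtd.norm hu
    rw [Zsqrtd.norm_mul, pow_two c, Zsqrtd.norm_mul] at hN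
    have hu1 : Zsqrtd.norm (u : Gi) = 1 := by
      rcases units_cases u.mul_inv with h | h | h | h <;> rw [h.1] <;> rfl
    rw [hu1] at hN
    simp [Zsqrtd.norm] at hN
    linear_combination -hN
  have hk : ∃ k, n0 = k ^ 2 := by
    rw [hn] at h h0
    have hd : (c.re ^ 2 + c.im ^ 2) ∣ y := by
      rw [← Int.pow_dvd_pow_iff (n := 2) (by norm_num)]
      exact ⟨n0, by rw [← h]; ring⟩
    obtain ⟨k, rfl⟩ := hd
    refine ⟨k, mul_right_cancel₀ h0 ?_⟩
    rw [h]; ring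
  obtain ⟨k, hk⟩ := hk
  rcases units_cases u.mul_inv with h | h | h | h <;> rw [h.1] at hu
  · exact ⟨c, k, hk, Or.inl (by rw [← hu]; ring)⟩
  · exact ⟨I * c, k, hk, Or.inl (by rw [← hu, I_sq2]; ring)⟩
  · exact ⟨c, k, hk, Or.inr (by rw [← hu]; ring)⟩
  · exact ⟨I * c, k, hk, Or.inr (by rw [← hu, I_sq2]; ring)⟩

lemma PT {x y k : ℤ} (h : k ^ 2 = x ^ 2 + y ^ 2) (hc : IsCoprime x y) (hx : x % 2 = 1) :
    ∃ m n σ : ℤ, (σ = 1 ∨ σ = -1) ∧ x = σ * (m ^ 2 - n ^ 2) ∧ y = σ * (2 * (m * n)) ∧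
      m % 2 = 1 ∧ n % 2 = 0 ∧ IsCoprime m n := by
  have hk : 0 < |k| := by
    rw [abs_pos]; rintro rfl
    have : x ^ 2 = 0 := by nlinarith [sq_nonneg x, sq_nonneg y]
    have : x = 0 := by simpa using this
    omega
  have hp : PythagoreanTriple x y |k| := by
    unfold PythagoreanTriple; rw [abs_mul_abs_self]; linarith
  obtain ⟨m, n, h1, h2, -, h4, h5, -⟩ := hp.coprime_classification'
    (Int.isCoprime_iff_gcd_eq_one.1 hc) hx hk
  have h6 := Int.isCoprime_iff_gcd_eq_one.2 h4
  rcases h5 with ⟨h5, h7⟩ | ⟨h5, h7⟩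
  · exact ⟨n, -m, -1, Or.inr rfl, by rw [h1]; ring, by rw [h2]; ring, h7, by omega,
      h6.symm.neg_right⟩
  · exact ⟨m, n, 1, Or.inl rfl, by rw [h1]; ring, by rw [h2]; ring, h5, h7, h6⟩

lemma copNh {W Z d1 d2 : Gi} (hc : IsCoprime W Z) (h1 : d1 ∣ Z ^ 2 - 2 * Z * W + 2 * W ^ 2)
    (h2 : d2 ∣ Z ^ 2 + W ^ 2 + W * (Z - W) * I) (hd : Od d1) : IsCoprime d1 d2 := by
  obtain ⟨p, q, hpq⟩ : IsCoprime (W ^ 3) (Z ^ 3) := hc.pow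
  have hk : IsCoprime d1 (2 ^ 2 * pi) := cop_two_pow 2 hd (od_coprime_pi hd)
  obtain ⟨N', hN⟩ := h1
  obtain ⟨h', hh⟩ := h2
  have e : (2 : Gi) ^ 2 * pi = d2 * (h' * (q * ((6 + 2 * I) * Z - 4 * W) +
      p * (-(2 + I) * Z + (3 + I) * W))) +
      d1 * (N' * (q * ((-2 + 2 * I) * Z + (2 - 2 * I) * W) + p * ((2 + I) * Z + 3 * I * W))) := by
    rw [← mul_assoc d1, ← mul_assoc d2, ← hN, ← hh, pi_eq]
    linear_combination (-(4 + 4 * I)) * hpq -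
      (q * (2 * Z ^ 2 * W - 2 * Z * W ^ 2) + p * (-Z ^ 2 * W + 2 * Z * W ^ 2 - W ^ 3)) * I2
  rw [e] at hk
  exact (IsCoprime.of_add_mul_left_right hk).of_mul_right_left

lemma cophh {W Z d1 d2 : Gi} (hc : IsCoprime W Z) (h1 : d1 ∣ Z ^ 2 + W ^ 2 + W * (Z - W) * I)
    (h2 : d2 ∣ Z ^ 2 + W ^ 2 - W * (Z - W) * I) (hd : Od d1) : IsCoprime d1 d2 := by
  obtain ⟨p, q, hpq⟩ : IsCoprime (W ^ 3) (Z ^ 3) := hc.pow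
  have hk : IsCoprime d1 (2 ^ 2 * 1) := cop_two_pow 2 hd isCoprime_one_right
  obtain ⟨N', hN⟩ := h1
  obtain ⟨h', hh⟩ := h2
  have e : (2 : Gi) ^ 2 * 1 = d2 * (h' * (q * ((2 * Z - W) + I * (Z - W)) +
      p * (W - I * (Z + W)))) +
      d1 * (N' * (q * ((2 * Z - W) - I * (Z - W)) + p * (W + I * (Z + W)))) := by
    rw [← mul_assoc d1, ← mul_assoc d2, ← hN, ← hh]
    linear_combination (-4) * hpq + (2 * q * W * (Z - W) ^ 2 - 2 * p * W * (Z - W) * (Z + W)) * I2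
  rw [e] at hk
  exact (IsCoprime.of_add_mul_left_right hk).of_mul_right_left

lemma lemA {p q k s : ℤ} (h1 : p ^ 2 - q ^ 2 = 8 * k + 1) (h2 : p * q = 2 * (2 * s + 1)) : False := by
  have key : ∀ p q s : ZMod 8, p ^ 2 - q ^ 2 = 1 → p * q = 2 * (2 * s + 1) → False := by decide
  have e1 := congrArg (Int.cast : ℤ → ZMod 8) h1
  have e2 := congrArg (Int.cast : ℤ → ZMod 8) h2
  push_cast at e1 e2
  have e8 : (8 : ZMod 8) = 0 := by rfl
  rw [e8, zero_mul, zero_add] at e1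
  exact key _ _ _ e1 e2

end N3M3

namespace N3M3

lemma re_eq {p q : ℤ} {c : Gi} (h : (p : Gi) + q * I = c ^ 2) :
    p = c.re ^ 2 - c.im ^ 2 ∧ q = 2 * (c.re * c.im) := by
  have h1 := re_of_eq h
  have h2 := im_of_eq h
  simp [pow_two] at h1 h2
  constructor
  · rw [h1]; ring
  · rw [h2]; ring

lemma re_eqI {p q : ℤ} {c : Gi} (h : (p : Gi) + q * I = I * c ^ 2) :
    p = - (2 * (c.re * c.im)) ∧ q = c.re ^ 2 - c.im ^ 2 := by
  have h1 := re_of_eq h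
  have h2 := im_of_eq h
  simp [pow_two] at h1 h2
  constructor
  · rw [h1]; ring
  · rw [h2]; ring

lemma od_pq {p q : ℤ} (h : (p + q) % 2 = 1) : Od ((p : Gi) + q * I) := by
  unfold Od; simpa using h

lemma caseA {W Z Y : ℤ} (hc : IsCoprime W Z) (hZ : Z % 2 = 1) (hW : W % 2 = 0)
    (h : (Z ^ 2 - 2 * Z * W + 2 * W ^ 2) * ((Z ^ 2 + W ^ 2) ^ 2 + (W * (Z - W)) ^ 2) = Y ^ 2) :
    W = 0 := by
  by_contra h0
  have hp : (Z ^ 2 + W ^ 2) % 2 = 1 := by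
    obtain ⟨x, hx⟩ := odd_sq hZ
    obtain ⟨w, hw⟩ : ∃ w, W = 2 * w := ⟨W / 2, by omega⟩
    rw [hx, hw, show 1 + 8 * x + (2 * w) ^ 2 = 2 * (4 * x + 2 * w ^ 2) + 1 by ring]; omega
  have hq : (W * (Z - W)) % 2 = 0 := by
    obtain ⟨w, hw⟩ : ∃ w, W = 2 * w := ⟨W / 2, by omega⟩
    rw [hw, mul_assoc]; omega
  have hN : (Z ^ 2 - 2 * Z * W + 2 * W ^ 2) % 2 = 1 := by
    have : Z ^ 2 - 2 * Z * W + 2 * W ^ 2 = (Z ^ 2 + W ^ 2) + (2 * (-(Z * W)) + W * W) := by ring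
    have h3 : (W * W) % 2 = 0 := by rw [Int.mul_emod, hW]; rfl
    rw [this]; omega
  have hod := od_pq (p := Z ^ 2 + W ^ 2) (q := W * (Z - W)) (by omega)
  have hcG := cop_cast hc
  obtain ⟨c, k, hk, hg⟩ := Fac h (by positivity) (by
    refine IsCoprime.mul_right (IsCoprime.symm ?_) ?_
    · exact copNh hcG (by push_cast; exact dvd_rfl) (by push_cast; exact dvd_rfl) (od_cast hN)
    · exact cophh hcG (by push_cast; exact dvd_rfl) (by push_cast; exact dvd_rfl) hod)
  rcases hg with hg | hg
  swap
  · have := (re_eqI hg).1; omega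
  obtain ⟨m, n, σ, hσ, hx, hy, hm, hn, hmn⟩ := PT (x := Z - W) (y := W) (k := k)
    (by rw [← hk]; ring) (by
      have := hc.symm.add_mul_right_left (-1)
      rwa [neg_one_mul, ← sub_eq_add_neg] at this) (by omega)
  have hσ2 : σ ^ 2 = 1 := by rcases hσ with rfl | rfl <;> rfl
  have hZe : Z = σ * (m ^ 2 - n ^ 2 + 2 * (m * n)) := by linear_combination hx + hy
  have e1 : Z ^ 2 + W ^ 2 = (m ^ 2 - n ^ 2) ^ 2 + 4 * (m ^ 2 - n ^ 2) * (m * n) + 8 * (m * n) ^ 2 := by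
    rw [hZe, hy]
    linear_combination ((m ^ 2 - n ^ 2) ^ 2 + 4 * (m ^ 2 - n ^ 2) * (m * n) + 8 * (m * n) ^ 2) * hσ2
  have e2 : W * (Z - W) = 2 * ((m ^ 2 - n ^ 2) * (m * n)) := by
    rw [hx, hy]; linear_combination 2 * ((m ^ 2 - n ^ 2) * (m * n)) * hσ2
  rw [e1, e2] at hg
  have hn0 : n ≠ 0 := by
    rintro rfl; apply h0; rw [hy]; ring
  have h4 : 4 ∣ n := by
    by_contra h4
    obtain ⟨r, hr⟩ : ∃ r, n = 2 * r := ⟨n / 2, by omega⟩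
    have hr1 : r % 2 = 1 := by omega
    obtain ⟨h5, h6⟩ := re_eq hg
    obtain ⟨a, ha⟩ := odd_sq hm
    obtain ⟨b, hb⟩ := odd_sq hr1
    obtain ⟨m1, hm1⟩ : ∃ m1, m = 2 * m1 + 1 := ⟨m / 2, by omega⟩
    obtain ⟨r1, hr2⟩ : ∃ r1, r = 2 * r1 + 1 := ⟨r / 2, by omega⟩
    have hA : m ^ 2 - n ^ 2 = 2 * (4 * a - 2 * r ^ 2) + 1 := by rw [ha, hr]; ring
    obtain ⟨t, ht⟩ := odd_sq (o := m ^ 2 - n ^ 2) (by rw [hA]; omega)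
    refine lemA (p := c.re) (q := c.im) (k := t + (m ^ 2 - n ^ 2) * (m * r) + 4 * (m * r) ^ 2)
      (s := (4 * a - 2 * r ^ 2) * (m * r) + 2 * m1 * r1 + m1 + r1) ?_ ?_
    · rw [← h5, ht, hr]; ring
    · have : c.re * c.im = (m ^ 2 - n ^ 2) * (m * n) := by linarith
      rw [this, hA, hr]
      rw [show m * r = 2 * (2 * m1 * r1 + m1 + r1) + 1 by rw [hm1, hr2]; ring,
        show m * (2 * r) = 2 * (2 * (2 * m1 * r1 + m1 + r1) + 1) by rw [hm1, hr2]; ring]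
      ring
  refine topA_int (c := c) hm h4 hn0 hmn ?_
  rw [← hg]; push_cast; ring

lemma caseB {W Z Y : ℤ} (hc : IsCoprime W Z) (hZ : Z % 2 = 1) (hW : W % 2 = 1)
    (h : (Z ^ 2 - 2 * Z * W + 2 * W ^ 2) * ((Z ^ 2 + W ^ 2) ^ 2 + (W * (Z - W)) ^ 2) = Y ^ 2) :
    W = Z := by
  by_contra h0
  obtain ⟨v, hv⟩ : ∃ v, W - Z = 2 * v := ⟨(W - Z) / 2, by omega⟩
  obtain rfl : Z = W - 2 * v := by omega
  obtain ⟨x, hx⟩ := odd_sq hW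
  have hY : ∃ Y', Y = 2 * Y' := by
    have h1 : (2 : ℤ) ∣ Y := by
      apply Int.prime_two.dvd_of_dvd_pow (n := 2)
      rw [← h]
      refine ⟨(W ^ 2 + 4 * v ^ 2) * 2 * ((W ^ 2 - 2 * W * v + 2 * v ^ 2) ^ 2 + (W * v) ^ 2), ?_⟩
      ring
    exact h1
  obtain ⟨Y', rfl⟩ := hY
  have h' : (W ^ 2 + 4 * v ^ 2) * ((W ^ 2 - 2 * W * v + 2 * v ^ 2) ^ 2 + (-(W * v)) ^ 2) = Y' ^ 2 := by
    apply mul_left_cancel₀ (show (4 : ℤ) ≠ 0 by norm_num)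
    linear_combination h
  have hve : v % 2 = 0 := by
    by_contra hv1
    have hv1 : v % 2 = 1 := by omega
    have key : ∀ W v y : ZMod 4, W ^ 2 = 1 → v ^ 2 = 1 →
      (W ^ 2 + 4 * v ^ 2) * ((W ^ 2 - 2 * W * v + 2 * v ^ 2) ^ 2 + (-(W * v)) ^ 2) = y ^ 2 → False := by
      decide
    obtain ⟨y, hy⟩ := odd_sq hv1
    have e8 : (8 : ZMod 4) = 0 := by rfl
    have e1 := congrArg (Int.cast : ℤ → ZMod 4) hx
    have e2 := congrArg (Int.cast : ℤ → ZMod 4) hy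
    have e3 := congrArg (Int.cast : ℤ → ZMod 4) h'
    push_cast at e1 e2 e3
    rw [e8, zero_mul, add_zero] at e1 e2
    exact key _ _ _ e1 e2 e3
  obtain ⟨u, rfl⟩ : ∃ u, v = 2 * u := ⟨v / 2, by omega⟩
  have hp : (W ^ 2 - 2 * W * (2 * u) + 2 * (2 * u) ^ 2) % 2 = 1 := by
    rw [hx, show 1 + 8 * x - 2 * W * (2 * u) + 2 * (2 * u) ^ 2 =
      2 * (4 * x - 2 * W * u + 4 * u ^ 2) + 1 by ring]; omega
  have hq : (-(W * (2 * u))) % 2 = 0 := by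
    rw [show (-(W * (2 * u))) = 2 * (-(W * u)) by ring]; omega
  have hN : (W ^ 2 + 4 * (2 * u) ^ 2) % 2 = 1 := by rw [hx]; omega
  have hod := od_pq (p := W ^ 2 - 2 * W * (2 * u) + 2 * (2 * u) ^ 2) (q := -(W * (2 * u))) (by omega)
  have hcG := cop_cast hc
  obtain ⟨c, k, hk, hg⟩ := Fac h' (by
      intro h3
      have h4 : (W ^ 2 - 2 * W * (2 * u) + 2 * (2 * u) ^ 2) ^ 2 = 0 := by nlinarith [sq_nonneg (W * (2 * u)), sq_nonneg (W ^ 2 - 2 * W * (2 * u) + 2 * (2 * u) ^ 2)]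
      rw [sq_eq_zero_iff] at h4
      omega) (by
    refine IsCoprime.mul_right (IsCoprime.symm ?_) ?_
    · exact copNh hcG ⟨1, by push_cast; ring⟩ ⟨2, by push_cast; ring⟩ (od_cast hN)
    · exact cophh hcG ⟨2, by push_cast; ring⟩ ⟨2, by push_cast; ring⟩ hod)
  rcases hg with hg | hg
  swap
  · have := (re_eqI hg).1; omega
  obtain ⟨m, n, σ, hσ, hx', hy, hm, hn, hmn⟩ := PT (x := W) (y := 2 * (2 * u)) (k := k)
    (by rw [← hk]; ring) (by
      have h3 := hc.add_mul_left_right (-1)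
      rw [show W - 2 * (2 * u) + W * -1 = -(2 * (2 * u)) by ring] at h3
      exact (IsCoprime.neg_right_iff _ _).1 h3) hW
  have hσ2 : σ ^ 2 = 1 := by rcases hσ with rfl | rfl <;> rfl
  have hv2 : 2 * u = σ * (m * n) := by linarith
  have e1 : W ^ 2 - 2 * W * (2 * u) + 2 * (2 * u) ^ 2 =
      (m ^ 2 - n ^ 2) ^ 2 - 2 * (m ^ 2 - n ^ 2) * (m * n) + 2 * (m * n) ^ 2 := by
    rw [hv2, hx']
    linear_combination ((m ^ 2 - n ^ 2) ^ 2 - 2 * (m ^ 2 - n ^ 2) * (m * n) + 2 * (m * n) ^ 2) * hσ2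
  have e2 : -(W * (2 * u)) = -((m ^ 2 - n ^ 2) * (m * n)) := by
    rw [hv2, hx']; linear_combination -((m ^ 2 - n ^ 2) * (m * n)) * hσ2
  rw [e1, e2] at hg
  have hn0 : n ≠ 0 := by
    rintro rfl; apply h0; rw [mul_zero, mul_zero] at hv2; omega
  obtain ⟨h5, h6⟩ := re_eq hg
  obtain ⟨r, hr⟩ : ∃ r, n = 2 * r := ⟨n / 2, by omega⟩
  obtain ⟨a, ha⟩ := odd_sq hm
  obtain ⟨m1, hm1⟩ : ∃ m1, m = 2 * m1 + 1 := ⟨m / 2, by omega⟩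
  have h4 : r % 2 = 0 := by
    by_contra hr1
    have hr1 : r % 2 = 1 := by omega
    obtain ⟨r1, hr2⟩ : ∃ r1, r = 2 * r1 + 1 := ⟨r / 2, by omega⟩
    have hA : m ^ 2 - n ^ 2 = 2 * (4 * a - 2 * r ^ 2) + 1 := by rw [ha, hr]; ring
    have hpq : c.re * c.im = 2 * (-((4 * a - 2 * r ^ 2) * (m * r)) - (2 * m1 * r1 + m1 + r1) - 1) + 1 := by
      have : 2 * (c.re * c.im) = -((m ^ 2 - n ^ 2) * (m * n)) := by linarith
      have e : (m ^ 2 - n ^ 2) * (m * n) = 2 * ((2 * (4 * a - 2 * r ^ 2)) * (m * r) +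
         (2 * (2 * m1 * r1 + m1 + r1) + 1)) := by
        rw [hA, hr]; rw [show 2 * (2 * m1 * r1 + m1 + r1) + 1 = m * r by rw [hm1, hr2]; ring]; ring
      rw [e] at this; linarith
    have hpq2 : (c.re * c.im) % 2 = 1 := by omega
    have h7 : c.re % 2 = 1 ∧ c.im % 2 = 1 := by
      rw [← Int.odd_iff, ← Int.odd_iff, ← Int.odd_mul, Int.odd_iff]; exact hpq2
    obtain ⟨s1, hs1⟩ := odd_sq h7.1
    obtain ⟨s2, hs2⟩ := odd_sq h7.2
    rw [← e1] at h5
    omega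
  obtain ⟨r', rfl⟩ : ∃ r', r = 2 * r' := ⟨r / 2, by omega⟩
  have h8 : 8 ∣ n := by
    by_contra h8
    have hr1 : r' % 2 = 1 := by omega
    obtain ⟨r1, hr2⟩ : ∃ r1, r' = 2 * r1 + 1 := ⟨r' / 2, by omega⟩
    have hA : m ^ 2 - n ^ 2 = 8 * (a - 2 * r' ^ 2) + 1 := by rw [ha, hr]; ring
    refine lemA (p := c.re) (q := c.im) (k := 8 * (a - 2 * r' ^ 2) ^ 2 + 2 * (a - 2 * r' ^ 2)
      - (m ^ 2 - n ^ 2) * (m * r') + 4 * (m * r') ^ 2)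
      (s := -(4 * (a - 2 * r' ^ 2)) * (m * r') - (2 * m1 * r1 + m1 + r1) - 1) ?_ ?_
    · rw [← h5]
      rw [show (m ^ 2 - n ^ 2) ^ 2 = (8 * (a - 2 * r' ^ 2) + 1) ^ 2 by rw [hA]]
      rw [show m * n = 4 * (m * r') by rw [hr]; ring]; ring
    · have : 2 * (c.re * c.im) = -((m ^ 2 - n ^ 2) * (m * n)) := by linarith
      rw [hA, show m * n = 4 * (m * r') by rw [hr]; ring] at this
      have e : m * r' = 2 * (2 * m1 * r1 + m1 + r1) + 1 := by rw [hm1, hr2]; ring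
      apply mul_left_cancel₀ (two_ne_zero (α := ℤ))
      linear_combination this - 4 * e
  refine topB_int (c := c) hm h8 hn0 hmn ?_
  rw [← hg]; push_cast; ring

lemma caseC {W Z Y : ℤ} (hc : IsCoprime W Z) (hZ : Z % 2 = 0) (hW : W % 2 = 1) (hZ0 : Z ≠ 0)
    (h : (Z ^ 2 - 2 * Z * W + 2 * W ^ 2) * ((Z ^ 2 + W ^ 2) ^ 2 + (W * (Z - W)) ^ 2) = Y ^ 2) :
    False := by
  obtain ⟨z, rfl⟩ : ∃ v, Z = 2 * v := ⟨Z / 2, by omega⟩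
  obtain ⟨x, hx⟩ := odd_sq hW
  have hY : (2 : ℤ) ∣ Y := by
    apply Int.prime_two.dvd_of_dvd_pow (n := 2)
    rw [← h]
    refine ⟨(2 * z ^ 2 - 2 * z * W + W ^ 2) * (((2 * z) ^ 2 + W ^ 2) ^ 2 + (W * (2 * z - W)) ^ 2), ?_⟩
    ring
  obtain ⟨Y', rfl⟩ := hY
  have h' : (z ^ 2 + (W - z) ^ 2) * ((W ^ 2 + 2 * z ^ 2 - W * z) ^ 2 + (2 * z ^ 2 + W * z) ^ 2) = Y' ^ 2 := by
    apply mul_left_cancel₀ (show (4 : ℤ) ≠ 0 by norm_num)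
    linear_combination h
  have hN : (z ^ 2 + (W - z) ^ 2) % 2 = 1 := by
    rw [show z ^ 2 + (W - z) ^ 2 = W ^ 2 + 2 * (z ^ 2 - z * W) by ring, hx]; omega
  have hpq : (W ^ 2 + 2 * z ^ 2 - W * z + (2 * z ^ 2 + W * z)) % 2 = 1 := by
    rw [hx]; ring_nf; omega
  have hod := od_pq hpq
  have hcG := cop_cast hc
  obtain ⟨c, k, hk, hg⟩ := Fac h' (by
      intro h3
      have h4 : (W ^ 2 + 2 * z ^ 2 - W * z) ^ 2 = 0 := by
        nlinarith [sq_nonneg (W ^ 2 + 2 * z ^ 2 - W * z), sq_nonneg (2 * z ^ 2 + W * z)]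
      have h5 : (2 * z ^ 2 + W * z) ^ 2 = 0 := by
        nlinarith [sq_nonneg (W ^ 2 + 2 * z ^ 2 - W * z), sq_nonneg (2 * z ^ 2 + W * z)]
      rw [sq_eq_zero_iff] at h4 h5
      omega) (by
    refine IsCoprime.mul_right (IsCoprime.symm ?_) ?_
    · refine copNh hcG ⟨2, by push_cast; ring⟩ ⟨1 - I, ?_⟩ (od_cast hN)
      push_cast
      linear_combination ((2 * (z : Gi) ^ 2 + W * z)) * I2
    · refine cophh hcG ⟨1 - I, ?_⟩ ⟨1 + I, ?_⟩ hod
      · push_cast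
        linear_combination ((2 * (z : Gi) ^ 2 + W * z)) * I2
      · push_cast
        linear_combination ((2 * (z : Gi) ^ 2 + W * z)) * I2)
  rcases hg with hg | hg
  swap
  · obtain ⟨h1, h2⟩ := re_eqI hg
    have hab : (c.re * c.im) % 2 = 0 := by
      by_contra h3
      have h7 : c.re % 2 = 1 ∧ c.im % 2 = 1 := by
        rw [← Int.odd_iff, ← Int.odd_iff, ← Int.odd_mul, Int.odd_iff]; omega
      obtain ⟨s1, hs1⟩ := odd_sq h7.1
      obtain ⟨s2, hs2⟩ := odd_sq h7.2
      omega
    have hzo : z % 2 = 1 := by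
      by_contra h3
      obtain ⟨v, hv⟩ : ∃ v, z = 2 * v := ⟨z / 2, by omega⟩
      rw [hx, hv, show W * (2 * v) = 2 * (W * v) by ring] at h1
      omega
    obtain ⟨v, hv⟩ : ∃ v, W - z = 2 * v := ⟨(W - z) / 2, by omega⟩
    obtain ⟨y, hy⟩ := odd_sq hzo
    have hk1 : k % 2 = 1 := by
      rw [hk] at hN
      by_contra h3
      obtain ⟨l, hl⟩ : ∃ l, k = 2 * l := ⟨k / 2, by omega⟩
      rw [hl, show (2 * l) ^ 2 = 2 * (2 * l ^ 2) by ring] at hN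
      omega
    obtain ⟨y2, hy2⟩ := odd_sq hk1
    have hv2 : v % 2 = 0 := by
      by_contra h3
      obtain ⟨y3, hy3⟩ := odd_sq (o := v) (by omega)
      rw [hv, mul_pow, hy, hy2, hy3] at hk
      omega
    obtain ⟨u, rfl⟩ : ∃ u, v = 2 * u := ⟨v / 2, by omega⟩
    have : W ^ 2 + 2 * z ^ 2 - W * z = 4 * (W * u) + 2 * z ^ 2 := by linear_combination W * hv
    rw [this, hy] at h1
    omega
  obtain ⟨h1, h2⟩ := re_eq hg
  have hze : (W * z) % 2 = 0 := by
    omega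
  have hz2 : z % 2 = 0 := by
    rcases Int.even_mul.1 (Int.even_iff.2 hze) with h3 | h3 <;> rw [Int.even_iff] at h3 <;> omega
  obtain ⟨m, n, σ, hσ, hx', hy, hm, hn, hmn⟩ := PT (x := W - z) (y := z) (k := k)
    (by rw [← hk]; ring) (by
      have := hc.of_mul_right_right.add_mul_right_left (-1)
      rwa [neg_one_mul, ← sub_eq_add_neg] at this) (by omega)
  have hσ2 : σ ^ 2 = 1 := by rcases hσ with rfl | rfl <;> rfl
  have hWe : W = σ * (m ^ 2 - n ^ 2 + 2 * (m * n)) := by linear_combination hx' + hy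
  have e1 : W ^ 2 + 2 * z ^ 2 - W * z =
      (m ^ 2 - n ^ 2) ^ 2 + 2 * (m ^ 2 - n ^ 2) * (m * n) + 8 * (m * n) ^ 2 := by
    rw [hWe, hy]
    linear_combination ((m ^ 2 - n ^ 2) ^ 2 + 2 * (m ^ 2 - n ^ 2) * (m * n) + 8 * (m * n) ^ 2) * hσ2
  have e2 : 2 * z ^ 2 + W * z = 2 * (m ^ 2 - n ^ 2) * (m * n) + 12 * (m * n) ^ 2 := by
    rw [hWe, hy]
    linear_combination (2 * (m ^ 2 - n ^ 2) * (m * n) + 12 * (m * n) ^ 2) * hσ2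
  rw [e1, e2] at hg
  have hn0 : n ≠ 0 := by
    rintro rfl; apply hZ0; rw [hy]; ring
  refine topC_int (c := c) hm (by omega) hn0 hmn ?_
  rw [← hg]; push_cast; ring

end N3M3

namespace N3M3

lemma main_int {W Z Y : ℤ} (hc : IsCoprime W Z) (hZ0 : Z ≠ 0)
    (h : (Z ^ 2 - 2 * Z * W + 2 * W ^ 2) * ((Z ^ 2 + W ^ 2) ^ 2 + (W * (Z - W)) ^ 2) = Y ^ 2) :
    W = 0 ∨ W = Z := by
  rcases Int.emod_two_eq_zero_or_one Z with hZ | hZ <;>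
  rcases Int.emod_two_eq_zero_or_one W with hW | hW
  · exfalso
    have := hc.isUnit_of_dvd' (Int.dvd_of_emod_eq_zero hW) (Int.dvd_of_emod_eq_zero hZ)
    rw [Int.isUnit_iff] at this; omega
  · exact (caseC hc hZ hW hZ0 h).elim
  · exact Or.inl (caseA hc hZ hW h)
  · exact Or.inr (caseB hc hZ hW h)

lemma main_rat {d w : ℚ} (h : (-2 * d + 1) * w ^ 3 + (2 * d - 1) * w ^ 2 +
    (-d ^ 2 - d + 1) * w + d ^ 2 - d = 0) : w = 0 ∨ w = 1 := by
  have hZ : (w.den : ℤ) ≠ 0 := by exact_mod_cast w.den_nz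
  have hE : (d.den : ℤ) ≠ 0 := by exact_mod_cast d.den_nz
  have hw : (w.num : ℚ) = w * w.den := (Rat.mul_den_eq_num w).symm
  have hd : (d.num : ℚ) = d * d.den := (Rat.mul_den_eq_num d).symm
  have hc : IsCoprime w.num (w.den : ℤ) := Rat.isCoprime_num_den w
  have key : (d.den : ℤ) ^ 2 * ((((w.den : ℤ) ^ 2 - 2 * w.den * w.num + 2 * w.num ^ 2)) *
      (((w.den : ℤ) ^ 2 + w.num ^ 2) ^ 2 + (w.num * (w.den - w.num)) ^ 2)) =
      (2 * (w.den - w.num) * w.den ^ 2 * d.num + d.den *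
        (-2 * w.num ^ 3 + 2 * w.num ^ 2 * w.den - w.num * w.den ^ 2 - w.den ^ 3)) ^ 2 := by
    have : ((d.den : ℚ)) ^ 2 * ((((w.den : ℚ) ^ 2 - 2 * w.den * w.num + 2 * w.num ^ 2)) *
      (((w.den : ℚ) ^ 2 + w.num ^ 2) ^ 2 + (w.num * (w.den - w.num)) ^ 2)) =
      (2 * (w.den - w.num) * w.den ^ 2 * d.num + d.den *
        (-2 * w.num ^ 3 + 2 * w.num ^ 2 * w.den - w.num * w.den ^ 2 - w.den ^ 3)) ^ 2 := by
      rw [hw, hd]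
      linear_combination (-4 * (1 - w) * (d.den : ℚ) ^ 2 * (w.den : ℚ) ^ 6) * h
    exact_mod_cast this
  have hdv : (d.den : ℤ) ∣ (2 * (w.den - w.num) * w.den ^ 2 * d.num + d.den *
        (-2 * w.num ^ 3 + 2 * w.num ^ 2 * w.den - w.num * w.den ^ 2 - w.den ^ 3)) := by
    rw [← Int.pow_dvd_pow_iff (n := 2) (by norm_num)]
    exact ⟨_, key.symm⟩
  obtain ⟨Y, hY⟩ := hdv
  rw [hY, mul_pow (d.den : ℤ) Y] at key
  rcases main_int hc hZ (mul_left_cancel₀ (pow_ne_zero 2 hE) key) with h1 | h1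
  · left; exact Rat.num_eq_zero.1 h1
  · right
    have : (w.num : ℚ) = w.den := by exact_mod_cast h1
    rw [hw] at this
    have h2 : (w.den : ℚ) ≠ 0 := by exact_mod_cast w.den_nz
    exact mul_right_cancel₀ h2 (by rw [this, one_mul])

end N3M3

theorem stmt_10 :
    {p : ℚ × ℚ |
        (-2 * p.1 + 1) * p.2 ^ 3 + (2 * p.1 - 1) * p.2 ^ 2 +
          (-p.1 ^ 2 - p.1 + 1) * p.2 + p.1 ^ 2 - p.1 = 0} =
      ({(0, 0), (1, 0), (1/2, 1)} : Set (ℚ × ℚ)) := by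
  ext ⟨d, w⟩
  simp only [Set.mem_ofPred_eq, Set.mem_insert_iff, Set.mem_singleton_iff, Prod.mk.injEq]
  constructor
  · intro h
    rcases N3M3.main_rat h with rfl | rfl
    · have h1 : d * (d - 1) = 0 := by linear_combination h
      rcases mul_eq_zero.1 h1 with h2 | h2
      · exact Or.inl ⟨h2, rfl⟩
      · exact Or.inr (Or.inl ⟨by linarith, rfl⟩)
    · exact Or.inr (Or.inr ⟨by linarith, rfl⟩)
  · rintro (⟨rfl, rfl⟩ | ⟨rfl, rfl⟩ | ⟨rfl, rfl⟩) <;> norm_num
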